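/- arXiv:2312.16515 — 5 statements merged into one kernel-verified Lean document; each statement's English description precedes it below -/
import Mathlib

section
/- For every p ∈ {0} ∪ [1,∞), the set L^quantile_p(λ^N) = {Q^μ : μ ∈ P_p(ℝ^N)} of p-integrable quantile processes is a G_δ subset of L_p(λ^N; ℝ^N). -/
open MeasureTheory ProbabilityTheory Filter Set
open scoped ENNReal NNReal Topology

/-- Lebesgue measure on `(0,1)`. -/
noncomputable def lambda01 : Measure ℝ := volume.restrict (Set.Ioo (0:ℝ) 1)

/-- The `N`-fold product of Lebesgue measure on `(0,1)`. -/
noncomputable def lambdaN (N : ℕ) : Measure (Fin N → ℝ) :=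
  Measure.pi fun _ => lambda01

/-- The open unit cube `(0,1)^N`. -/
def cube (N : ℕ) : Set (Fin N → ℝ) := {u | ∀ i, u i ∈ Set.Ioo (0:ℝ) 1}

/-- A map is triangular (adapted) if its `k`-th component depends only on the first `k`
coordinates. -/
def Triangular {N : ℕ} (Q : (Fin N → ℝ) → Fin N → ℝ) : Prop :=
  ∀ (k : Fin N) (u v : Fin N → ℝ), (∀ j ≤ k, u j = v j) → Q u k = Q v k

/-- Monotonicity condition (inc) on a set `s`: the `k`-th component is increasing in the
`k`-th coordinate (the earlier coordinates being fixed). -/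
def IncOn {N : ℕ} (Q : (Fin N → ℝ) → Fin N → ℝ) (s : Set (Fin N → ℝ)) : Prop :=
  ∀ k : Fin N, ∀ u ∈ s, ∀ v ∈ s, (∀ j < k, u j = v j) → u k ≤ v k → Q u k ≤ Q v k

/-- Strict monotonicity condition (sinc) on a set `s`. -/
def StrictIncOn {N : ℕ} (Q : (Fin N → ℝ) → Fin N → ℝ) (s : Set (Fin N → ℝ)) : Prop :=
  ∀ k : Fin N, ∀ u ∈ s, ∀ v ∈ s, (∀ j < k, u j = v j) → u k < v k → Q u k < Q v k

/-- Consistency condition (con) on a set `s`: if changing only the `k`-th coordinate does not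
change the `k`-th component, then it does not change any later component `m ≥ k`. -/
def ConOn {N : ℕ} (Q : (Fin N → ℝ) → Fin N → ℝ) (s : Set (Fin N → ℝ)) : Prop :=
  ∀ k m : Fin N, k ≤ m → ∀ u ∈ s, ∀ v ∈ s, (∀ j ≠ k, u j = v j) →
    Q u k = Q v k → Q u m = Q v m

/-- A quantile process: a Borel triangular map satisfying (inc) and (con) on the unit cube. -/
structure IsQuantileProcess {N : ℕ} (Q : (Fin N → ℝ) → Fin N → ℝ) : Prop where
  measurable : Measurable Q
  triangular : Triangular Q
  inc : IncOn Q (cube N)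
  con : ConOn Q (cube N)

/-- The (a.e. unique) quantile process of `μ`, chosen via Hilbert's epsilon operator. -/
noncomputable def quantileProcess {N : ℕ} (μ : Measure (Fin N → ℝ)) :
    (Fin N → ℝ) → Fin N → ℝ :=
  Classical.epsilon fun Q => IsQuantileProcess Q ∧ (lambdaN N).map Q = μ

/-- The cost `|x - y|_p^p = ∑ₖ |xₖ - yₖ|^p`, valued in `ℝ≥0∞`. -/
noncomputable def pCost (p : ℝ) {N : ℕ} (x y : Fin N → ℝ) : ℝ≥0∞ :=
  ∑ k, ENNReal.ofReal (|x k - y k| ^ p)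

/-- The bounded cost `|x - y| ∧ 1` used for `p = 0`. -/
noncomputable def cost0 {N : ℕ} (x y : Fin N → ℝ) : ℝ≥0∞ :=
  ENNReal.ofReal (min ‖x - y‖ 1)

/-- The `L_p(λ^N; ℝ^N)`-distance of two maps `(0,1)^N → ℝ^N`
(for `p = 0` the distance `∫ |f - g| ∧ 1 dλ^N` of convergence in probability). -/
noncomputable def Ldist (p : ℝ) {N : ℕ} (f g : (Fin N → ℝ) → Fin N → ℝ) : ℝ≥0∞ :=
  if p = 0 then ∫⁻ u, cost0 (f u) (g u) ∂(lambdaN N)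
  else (∫⁻ u, pCost p (f u) (g u) ∂(lambdaN N)) ^ p⁻¹

/-- `μ ∈ P_p(ℝ^N)`: a Borel probability measure with finite `p`-th moments
(no moment condition when `p = 0`). -/
def MemPp (p : ℝ) {N : ℕ} (μ : Measure (Fin N → ℝ)) : Prop :=
  IsProbabilityMeasure μ ∧
    (p = 0 ∨ ∫⁻ x, ∑ k, ENNReal.ofReal (|x k| ^ p) ∂μ < ⊤)

/-- `T` is `p`-integrable w.r.t. `λ^N` (no condition when `p = 0`). -/
def FinLp (p : ℝ) {N : ℕ} (T : (Fin N → ℝ) → Fin N → ℝ) : Prop :=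
  p = 0 ∨ ∫⁻ u, ∑ k, ENNReal.ofReal (|T u k| ^ p) ∂(lambdaN N) < ⊤

/-- The Knothe–Rosenblatt distance `KR_p(μ,ν)` (for `p = 0` the metric
`∫ |Q^μ - Q^ν| ∧ 1 dλ^N`). -/
noncomputable def KRdist (p : ℝ) {N : ℕ} (μ ν : Measure (Fin N → ℝ)) : ℝ≥0∞ :=
  Ldist p (quantileProcess μ) (quantileProcess ν)

/-! ### The reference measure -/

instance isProbabilityMeasure_lambda01 : IsProbabilityMeasure lambda01 :=
  ⟨by simp [lambda01]⟩

instance isProbabilityMeasure_lambdaN (N : ℕ) : IsProbabilityMeasure (lambdaN N) := by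
  unfold lambdaN; infer_instance

lemma ae_lambda01_mem_Ioo : ∀ᵐ t ∂lambda01, t ∈ Ioo (0 : ℝ) 1 :=
  ae_restrict_mem measurableSet_Ioo

lemma ae_lambdaN_mem_cube (N : ℕ) : ∀ᵐ u ∂lambdaN N, u ∈ cube N := by
  have h : ∀ i : Fin N, ∀ᵐ u ∂lambdaN N, u i ∈ Ioo (0 : ℝ) 1 := fun i =>
    Measure.tendsto_eval_ae_ae.eventually (ae_lambda01_mem_Ioo)
  exact ae_all_iff.2 h

/-- Resampling one coordinate preserves the product measure. -/
lemma measurePreserving_update {N : ℕ} (m : Fin N) :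
    MeasurePreserving (fun z : (Fin N → ℝ) × ℝ => Function.update z.1 m z.2)
      ((lambdaN N).prod lambda01) (lambdaN N) := by
  have hmeas : Measurable fun z : (Fin N → ℝ) × ℝ => Function.update z.1 m z.2 :=
    measurable_update'
  refine ⟨hmeas, ?_⟩
  refine (Measure.pi_eq fun s hs => ?_).symm
  rw [Measure.map_apply hmeas (MeasurableSet.univ_pi hs)]
  have hpre : (fun z : (Fin N → ℝ) × ℝ => Function.update z.1 m z.2) ⁻¹' univ.pi s
      = univ.pi (Function.update s m univ) ×ˢ s m := by
    ext ⟨u, t⟩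
    simp only [mem_preimage, mem_univ_pi, mem_prod]
    constructor
    · intro h
      refine ⟨fun i => ?_, by simpa using h m⟩
      by_cases hi : i = m
      · subst hi; simp
      · simpa [hi] using h i
    · rintro ⟨h, ht⟩ i
      by_cases hi : i = m
      · subst hi; simpa using ht
      · simpa [hi] using h i
  rw [hpre, Measure.prod_prod, lambdaN, Measure.pi_pi,
    ← Finset.mul_prod_erase _ _ (Finset.mem_univ m),
    ← Finset.mul_prod_erase _ (fun i => lambda01 (s i)) (Finset.mem_univ m)]
  simp only [Function.update_self, measure_univ, one_mul]
  rw [mul_comm]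
  congr 1
  refine Finset.prod_congr rfl fun i hi => ?_
  rw [Function.update_of_ne (Finset.ne_of_mem_erase hi)]

lemma ae_ae_update_of_ae {N : ℕ} (m : Fin N) {P : (Fin N → ℝ) → Prop}
    (h : ∀ᵐ u ∂lambdaN N, P u) :
    ∀ᵐ u ∂lambdaN N, ∀ᵐ t ∂lambda01, P (Function.update u m t) :=
  Measure.ae_ae_of_ae_prod ((measurePreserving_update m).quasiMeasurePreserving.ae h)

lemma ae_of_ae_ae_update {N : ℕ} (m : Fin N) {P : (Fin N → ℝ) → Prop}
    (hP : MeasurableSet {u | P u})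
    (h : ∀ᵐ u ∂lambdaN N, ∀ᵐ t ∂lambda01, P (Function.update u m t)) :
    ∀ᵐ u ∂lambdaN N, P u := by
  have hmp := measurePreserving_update m
  rw [← hmp.map_eq, ae_map_iff hmp.measurable.aemeasurable hP]
  exact (Measure.ae_prod_iff_ae_ae (hmp.measurable hP)).2 h

lemma exists_mem_Ioo_of_ae_lambda01 {P : ℝ → Prop} (h : ∀ᵐ t ∂lambda01, P t) {a b : ℝ}
    (hab : a < b) (ha : 0 ≤ a) (hb : b ≤ 1) : ∃ t ∈ Ioo a b, P t := by
  by_contra! hne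
  have hnull : lambda01 (Ioo a b) = 0 := measure_mono_null (fun t ht => hne t ht) h
  rw [lambda01, Measure.restrict_apply measurableSet_Ioo,
    inter_eq_left.2 (Ioo_subset_Ioo ha hb), Real.volume_Ioo] at hnull
  simp only [ENNReal.ofReal_eq_zero] at hnull
  linarith

/-! ### Convergence in probability and the `L_p` distance -/

lemma measurable_cost0 {N : ℕ} {f g : (Fin N → ℝ) → Fin N → ℝ} (hf : Measurable f)
    (hg : Measurable g) : Measurable fun u => cost0 (f u) (g u) := by
  unfold cost0
  exact (((hf.sub hg).norm).min measurable_const).ennreal_ofReal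

lemma cost0_le_add_mul_pCost {N : ℕ} {p ε : ℝ} (hp : 0 < p) (hε : 0 < ε) (x y : Fin N → ℝ) :
    cost0 x y ≤ ENNReal.ofReal ε + ENNReal.ofReal (ε ^ (-p)) * pCost p x y := by
  by_cases h : ‖x - y‖ ≤ ε
  · exact le_add_right (ENNReal.ofReal_le_ofReal ((min_le_left _ _).trans h))
  · obtain ⟨k, hk⟩ : ∃ k, ε < |x k - y k| := by
      by_contra! hne
      exact h ((pi_norm_le_iff_of_nonneg hε.le).2 fun k => by simpa using hne k)
    refine le_add_left ?_
    calc cost0 x y ≤ ENNReal.ofReal 1 := ENNReal.ofReal_le_ofReal (min_le_right _ _)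
      _ ≤ ENNReal.ofReal (ε ^ (-p) * |x k - y k| ^ p) := by
        refine ENNReal.ofReal_le_ofReal ?_
        rw [Real.rpow_neg hε.le, ← div_eq_inv_mul, one_le_div (Real.rpow_pos_of_pos hε p)]
        exact Real.rpow_le_rpow hε.le hk.le hp.le
      _ = ENNReal.ofReal (ε ^ (-p)) * ENNReal.ofReal (|x k - y k| ^ p) :=
        ENNReal.ofReal_mul (Real.rpow_nonneg hε.le _)
      _ ≤ _ := by
        gcongr
        exact Finset.single_le_sum (f := fun k => ENNReal.ofReal (|x k - y k| ^ p))
          (fun _ _ => zero_le) (Finset.mem_univ k)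

lemma exists_lintegral_cost0_lt_of_Ldist_lt {N : ℕ} {p : ℝ} (hp : p = 0 ∨ 1 ≤ p) {η : ℝ≥0∞}
    (hη : 0 < η) :
    ∃ ε : ℝ≥0∞, 0 < ε ∧ ∀ f g : (Fin N → ℝ) → Fin N → ℝ,
      Ldist p f g < ε → ∫⁻ u, cost0 (f u) (g u) ∂lambdaN N < η := by
  rcases hp with rfl | hp
  · exact ⟨η, hη, fun f g h => by simpa [Ldist] using h⟩
  have hp0 : 0 < p := by linarith
  obtain ⟨r, hr, hrη⟩ := ENNReal.lt_iff_exists_nnreal_btwn.1 hη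
  have hr' : (0 : ℝ) < r := by simpa using hr
  set ε : ℝ := r / 2
  have hε : 0 < ε := by positivity
  have hεp : 0 < ε ^ (-p) := Real.rpow_pos_of_pos hε _
  refine ⟨ENNReal.ofReal (ε / ε ^ (-p)) ^ p⁻¹, ?_, fun f g h => ?_⟩
  · exact ENNReal.rpow_pos (by simpa using by positivity) ENNReal.ofReal_ne_top
  rw [Ldist, if_neg hp0.ne', ENNReal.rpow_lt_rpow_iff (by positivity)] at h
  calc ∫⁻ u, cost0 (f u) (g u) ∂lambdaN N
      ≤ ∫⁻ u, (ENNReal.ofReal ε + ENNReal.ofReal (ε ^ (-p)) * pCost p (f u) (g u)) ∂lambdaN N :=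
        lintegral_mono fun u => cost0_le_add_mul_pCost hp0 hε _ _
    _ = ENNReal.ofReal ε
        + ENNReal.ofReal (ε ^ (-p)) * ∫⁻ u, pCost p (f u) (g u) ∂lambdaN N := by
        rw [lintegral_add_left measurable_const, lintegral_const_mul' _ _ ENNReal.ofReal_ne_top]
        simp
    _ ≤ ENNReal.ofReal ε + ENNReal.ofReal (ε ^ (-p)) * ENNReal.ofReal (ε / ε ^ (-p)) := by
        gcongr
    _ = r := by
        rw [← ENNReal.ofReal_mul hεp.le, mul_div_cancel₀ _ hεp.ne',
          ← ENNReal.ofReal_add hε.le hε.le, add_halves, ENNReal.ofReal_coe_nnreal]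
    _ < η := hrη

/-! ### Regular monotone kernels -/

lemma abs_arctan_sub_arctan_le (a b : ℝ) : |Real.arctan a - Real.arctan b| ≤ |a - b| := by
  have h := Convex.norm_image_sub_le_of_norm_deriv_le (f := Real.arctan) (C := 1) (s := univ)
    (x := b) (y := a) (fun x _ => Real.differentiableAt_arctan x) (fun x _ => ?_) convex_univ
    (mem_univ _) (mem_univ _)
  · simpa using h
  · rw [Real.deriv_arctan, Real.norm_of_nonneg (by positivity), div_le_one (by positivity)]
    nlinarith [sq_nonneg x]

lemma abs_arctan_le_two (a : ℝ) : |Real.arctan a| ≤ 2 := by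
  rw [abs_le]
  constructor <;>
    linarith [Real.neg_pi_div_two_lt_arctan a, Real.arctan_lt_pi_div_two a, Real.pi_le_four]

lemma abs_arctan_sub_arctan_le_four_mul_min (a b : ℝ) :
    |Real.arctan a - Real.arctan b| ≤ 4 * min |a - b| 1 := by
  have h2 : |Real.arctan a - Real.arctan b| ≤ 4 :=
    (abs_sub _ _).trans (by linarith [abs_arctan_le_two a, abs_arctan_le_two b])
  rcases min_cases |a - b| 1 with ⟨h, -⟩ | ⟨h, -⟩ <;> rw [h]
  · linarith [abs_arctan_sub_arctan_le a b, abs_nonneg (a - b)]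
  · linarith

/-- The coordinates of `x` strictly before `m`, padded with zeros. -/
def prefixPart {N : ℕ} (m : Fin N) (x : Fin N → ℝ) : Fin N → ℝ :=
  fun j => if j < m then x j else 0

lemma measurable_prefixPart {N : ℕ} (m : Fin N) : Measurable (prefixPart m) := by
  refine measurable_pi_iff.2 fun j => ?_
  unfold prefixPart
  by_cases h : j < m
  · simpa [h] using measurable_pi_apply j
  · simp [h]

lemma prefixPart_congr {N : ℕ} {m : Fin N} {x y : Fin N → ℝ} (h : ∀ j < m, x j = y j) :
    prefixPart m x = prefixPart m y := by
  ext j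
  by_cases hj : j < m <;> simp [prefixPart, hj, h]

lemma eq_of_prefixPart_eq {N : ℕ} {m : Fin N} {x y : Fin N → ℝ}
    (h : prefixPart m x = prefixPart m y) : ∀ j < m, x j = y j := fun j hj => by
  simpa [prefixPart, hj] using congrFun h j

lemma norm_prefixPart_sub_le {N : ℕ} (m : Fin N) (x y : Fin N → ℝ) :
    ‖prefixPart m x - prefixPart m y‖ ≤ ‖x - y‖ := by
  refine (pi_norm_le_iff_of_nonneg (norm_nonneg _)).2 fun j => ?_
  by_cases hj : j < m
  · simpa [prefixPart, hj] using norm_le_pi_norm (x - y) j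
  · simp [prefixPart, hj]

/-- Kernels `φ x t`, increasing in `t`, jointly measurable, and uniformly continuous in `x`
in a quantitative form suited to convergence in probability. -/
structure IsRegularKernel {N : ℕ} (φ : (Fin N → ℝ) → ℝ → ℝ) : Prop where
  measurable : Measurable fun z : (Fin N → ℝ) × ℝ => φ z.1 z.2
  monotone : ∀ x, Monotone (φ x)
  modulus : ∀ ε : ℝ, 0 < ε → ∃ C : ℝ, 0 ≤ C ∧
    ∀ x y t, |φ x t - φ y t| ≤ ε + C * min ‖x - y‖ 1

lemma isRegularKernel_const {N : ℕ} (c : ℝ) :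
    IsRegularKernel fun (_ : Fin N → ℝ) (_ : ℝ) => c where
  measurable := measurable_const
  monotone _ := monotone_const
  modulus ε hε := ⟨0, le_rfl, fun x y t => by simpa using hε.le⟩

lemma IsRegularKernel.add {N : ℕ} {φ ψ : (Fin N → ℝ) → ℝ → ℝ} (hφ : IsRegularKernel φ)
    (hψ : IsRegularKernel ψ) : IsRegularKernel fun x t => φ x t + ψ x t where
  measurable := hφ.measurable.add hψ.measurable
  monotone x := (hφ.monotone x).add (hψ.monotone x)
  modulus ε hε := by
    obtain ⟨C, hC, h⟩ := hφ.modulus (ε / 2) (half_pos hε)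
    obtain ⟨D, hD, h'⟩ := hψ.modulus (ε / 2) (half_pos hε)
    refine ⟨C + D, add_nonneg hC hD, fun x y t => ?_⟩
    calc |φ x t + ψ x t - (φ y t + ψ y t)|
        = |(φ x t - φ y t) + (ψ x t - ψ y t)| := by ring_nf
      _ ≤ |φ x t - φ y t| + |ψ x t - ψ y t| := abs_add_le _ _
      _ ≤ _ := by linarith [h x y t, h' x y t]

lemma IsRegularKernel.sum {N : ℕ} {ι : Type*} (s : Finset ι)
    {φ : ι → (Fin N → ℝ) → ℝ → ℝ} (hφ : ∀ i ∈ s, IsRegularKernel (φ i)) :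
    IsRegularKernel fun x t => ∑ i ∈ s, φ i x t := by
  classical
  induction s using Finset.induction_on with
  | empty => simpa using isRegularKernel_const 0
  | insert i s hi ih =>
    simp only [Finset.sum_insert hi]
    exact (hφ i (by simp)).add (ih fun j hj => hφ j (by simp [hj]))

/-- A nonnegative uniformly continuous weight times an increasing indicator. -/
lemma isRegularKernel_mul {N : ℕ} {w : (Fin N → ℝ) → ℝ} {s : ℝ → ℝ} {B : ℝ}
    (hw : UniformContinuous w) (hw0 : ∀ x, 0 ≤ w x) (hwB : ∀ x, w x ≤ B)
    (hs : Monotone s) (hs0 : ∀ t, 0 ≤ s t) (hs1 : ∀ t, s t ≤ 1) :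
    IsRegularKernel fun x t => w x * s t where
  measurable := (hw.continuous.measurable.comp measurable_fst).mul
    (hs.measurable.comp measurable_snd)
  monotone x := fun a b hab => mul_le_mul_of_nonneg_left (hs hab) (hw0 x)
  modulus ε hε := by
    obtain ⟨δ, hδ, h⟩ := Metric.uniformContinuous_iff.1 hw ε hε
    have hB : 0 ≤ B := (hw0 0).trans (hwB 0)
    have hδ1 : 0 < min δ 1 := lt_min hδ one_pos
    refine ⟨B / min δ 1, by positivity, fun x y t => ?_⟩
    rw [← sub_mul, abs_mul, abs_of_nonneg (hs0 t)]
    have hle : |w x - w y| ≤ ε + B / min δ 1 * min ‖x - y‖ 1 := by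
      by_cases hxy : ‖x - y‖ < δ
      · have := h (a := x) (b := y) (by rwa [dist_eq_norm])
        rw [Real.dist_eq] at this
        have : 0 ≤ B / min δ 1 * min ‖x - y‖ 1 := by positivity
        linarith
      · have h1 : min δ 1 ≤ min ‖x - y‖ 1 := min_le_min_right _ (not_lt.1 hxy)
        have h2 : B ≤ B / min δ 1 * min ‖x - y‖ 1 := by
          rw [div_mul_eq_mul_div, le_div_iff₀ hδ1]
          gcongr
        have h3 : |w x - w y| ≤ B := by
          rw [abs_le]; constructor <;> linarith [hw0 x, hw0 y, hwB x, hwB y]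
        linarith
    calc |w x - w y| * s t ≤ |w x - w y| * 1 := by gcongr; exact hs1 t
      _ ≤ _ := by simpa using hle

/-- The distance of (the arctangent of) the `m`-th component of `f` to the kernel `φ` evaluated
at the earlier components of `f` and the `m`-th coordinate. -/
noncomputable def kernelDist {N : ℕ} (m : Fin N) (φ : (Fin N → ℝ) → ℝ → ℝ)
    (f : (Fin N → ℝ) → Fin N → ℝ) : ℝ≥0∞ :=
  ∫⁻ u, ENNReal.ofReal |Real.arctan (f u m) - φ (prefixPart m (f u)) (u m)| ∂lambdaN N

lemma measurable_kernel_prefixPart {N : ℕ} {φ : (Fin N → ℝ) → ℝ → ℝ}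
    (hφ : Measurable fun z : (Fin N → ℝ) × ℝ => φ z.1 z.2) (m : Fin N)
    {f : (Fin N → ℝ) → Fin N → ℝ} (hf : Measurable f) :
    Measurable fun u => φ (prefixPart m (f u)) (u m) :=
  hφ.comp (((measurable_prefixPart m).comp hf).prodMk (measurable_pi_apply m))

lemma measurable_kernelDist_integrand {N : ℕ} {φ : (Fin N → ℝ) → ℝ → ℝ}
    (hφ : Measurable fun z : (Fin N → ℝ) × ℝ => φ z.1 z.2) (m : Fin N)
    {f : (Fin N → ℝ) → Fin N → ℝ} (hf : Measurable f) :
    Measurable fun u =>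
      ENNReal.ofReal |Real.arctan (f u m) - φ (prefixPart m (f u)) (u m)| := by
  have h1 : Measurable fun u => f u m := hf.eval
  have h2 := (Real.measurable_arctan.comp h1).sub (measurable_kernel_prefixPart hφ m hf)
  exact ENNReal.measurable_ofReal.comp (continuous_abs.measurable.comp h2)

lemma kernelDist_congr_ae {N : ℕ} (m : Fin N) (φ : (Fin N → ℝ) → ℝ → ℝ)
    {f g : (Fin N → ℝ) → Fin N → ℝ} (h : f =ᵐ[lambdaN N] g) :
    kernelDist m φ f = kernelDist m φ g :=
  lintegral_congr_ae (h.mono fun u hu => by simp only [hu])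

lemma exists_kernelDist_lt {N : ℕ} {φ : (Fin N → ℝ) → ℝ → ℝ} (hφ : IsRegularKernel φ)
    (m : Fin N) {f : (Fin N → ℝ) → Fin N → ℝ} (hf : Measurable f) {c : ℝ≥0∞}
    (hc : kernelDist m φ f < c) :
    ∃ η : ℝ≥0∞, 0 < η ∧ ∀ g, Measurable g → ∫⁻ u, cost0 (f u) (g u) ∂lambdaN N < η →
      kernelDist m φ g < c := by
  obtain ⟨r, hr, hrc⟩ := ENNReal.lt_iff_exists_add_pos_lt.1 hc
  have hr' : (0 : ℝ) < r := by simpa using hr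
  obtain ⟨C, hC, hmod⟩ := hφ.modulus (r / 2) (half_pos hr')
  have hC4 : 0 < C + 4 := by linarith
  refine ⟨ENNReal.ofReal (r / 2 / (C + 4)), by simpa using by positivity, fun g hg hfg => ?_⟩
  have hpt : ∀ u, ENNReal.ofReal |Real.arctan (g u m) - φ (prefixPart m (g u)) (u m)|
      ≤ ENNReal.ofReal |Real.arctan (f u m) - φ (prefixPart m (f u)) (u m)|
        + (ENNReal.ofReal (r / 2) + ENNReal.ofReal (C + 4) * cost0 (f u) (g u)) := by
    intro u
    have hmin : 0 ≤ min ‖f u - g u‖ 1 := by positivity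
    rw [cost0, ← ENNReal.ofReal_mul hC4.le, ← ENNReal.ofReal_add (by positivity) (by positivity),
      ← ENNReal.ofReal_add (by positivity) (by positivity)]
    refine ENNReal.ofReal_le_ofReal ?_
    have h1 : |Real.arctan (g u m) - Real.arctan (f u m)| ≤ 4 * min ‖f u - g u‖ 1 := by
      rw [abs_sub_comm]
      refine (abs_arctan_sub_arctan_le_four_mul_min _ _).trans ?_
      have := norm_le_pi_norm (f u - g u) m
      rw [Pi.sub_apply, Real.norm_eq_abs] at this
      gcongr
    have h2 : |φ (prefixPart m (f u)) (u m) - φ (prefixPart m (g u)) (u m)|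
        ≤ r / 2 + C * min ‖f u - g u‖ 1 := by
      refine (hmod _ _ _).trans ?_
      gcongr
      exact norm_prefixPart_sub_le m _ _
    have h3 := abs_add_le
      ((Real.arctan (g u m) - Real.arctan (f u m))
        + (Real.arctan (f u m) - φ (prefixPart m (f u)) (u m)))
      (φ (prefixPart m (f u)) (u m) - φ (prefixPart m (g u)) (u m))
    have h4 := abs_add_le (Real.arctan (g u m) - Real.arctan (f u m))
      (Real.arctan (f u m) - φ (prefixPart m (f u)) (u m))
    have h5 : Real.arctan (g u m) - φ (prefixPart m (g u)) (u m)
        = (Real.arctan (g u m) - Real.arctan (f u m))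
        + (Real.arctan (f u m) - φ (prefixPart m (f u)) (u m))
        + (φ (prefixPart m (f u)) (u m) - φ (prefixPart m (g u)) (u m)) := by ring
    rw [h5]
    linarith
  calc kernelDist m φ g
      ≤ ∫⁻ u, (ENNReal.ofReal |Real.arctan (f u m) - φ (prefixPart m (f u)) (u m)|
        + (ENNReal.ofReal (r / 2) + ENNReal.ofReal (C + 4) * cost0 (f u) (g u))) ∂lambdaN N :=
        lintegral_mono hpt
    _ = kernelDist m φ f + (ENNReal.ofReal (r / 2)
        + ENNReal.ofReal (C + 4) * ∫⁻ u, cost0 (f u) (g u) ∂lambdaN N) := by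
        rw [lintegral_add_left (measurable_kernelDist_integrand hφ.measurable m hf),
          lintegral_add_left measurable_const, lintegral_const_mul _ (measurable_cost0 hf hg)]
        simp [kernelDist]
    _ ≤ kernelDist m φ f + (ENNReal.ofReal (r / 2)
        + ENNReal.ofReal (C + 4) * ENNReal.ofReal (r / 2 / (C + 4))) := by gcongr
    _ = kernelDist m φ f + r := by
        rw [← ENNReal.ofReal_mul hC4.le, mul_div_cancel₀ _ hC4.ne',
          ← ENNReal.ofReal_add (by positivity) (by positivity), add_halves,
          ENNReal.ofReal_coe_nnreal]
    _ < c := hrc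

/-! ### Processes generated by kernels -/

/-- One step of the recursion computing a process from its kernels. -/
noncomputable def kernelStep {N : ℕ} (Φ : Fin N → (Fin N → ℝ) → ℝ → ℝ) (u x : Fin N → ℝ) :
    Fin N → ℝ :=
  fun m => Φ m (prefixPart m x) (u m)

/-- The process whose `m`-th component is the kernel `Φ m` evaluated at the earlier components
and at the `m`-th coordinate. -/
noncomputable def kernelProcess {N : ℕ} (Φ : Fin N → (Fin N → ℝ) → ℝ → ℝ) (u : Fin N → ℝ) :
    Fin N → ℝ :=
  (kernelStep Φ u)^[N] 0

lemma kernelStep_iterate_congr {N : ℕ} (Φ : Fin N → (Fin N → ℝ) → ℝ → ℝ) (u x y : Fin N → ℝ)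
    (n : ℕ) : ∀ j : Fin N, (j : ℕ) < n → (kernelStep Φ u)^[n] x j = (kernelStep Φ u)^[n] y j := by
  induction n with
  | zero => intro j hj; omega
  | succ n ih =>
    intro j hj
    rw [Function.iterate_succ_apply', Function.iterate_succ_apply', kernelStep, kernelStep,
      prefixPart_congr fun i hi => ih i (by have : (i : ℕ) < j := hi; omega)]

lemma kernelProcess_apply {N : ℕ} (Φ : Fin N → (Fin N → ℝ) → ℝ → ℝ) (u : Fin N → ℝ)
    (m : Fin N) :
    kernelProcess Φ u m = Φ m (prefixPart m (kernelProcess Φ u)) (u m) := by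
  calc kernelProcess Φ u m = (kernelStep Φ u)^[N] (kernelStep Φ u 0) m :=
        kernelStep_iterate_congr Φ u _ _ N m m.2
    _ = kernelStep Φ u (kernelProcess Φ u) m := by
        rw [← Function.iterate_succ_apply, Function.iterate_succ_apply', kernelProcess]

lemma measurable_kernelProcess {N : ℕ} {Φ : Fin N → (Fin N → ℝ) → ℝ → ℝ}
    (hΦ : ∀ m, Measurable fun z : (Fin N → ℝ) × ℝ => Φ m z.1 z.2) :
    Measurable (kernelProcess Φ) := by
  have h : ∀ n : ℕ, Measurable fun u => (kernelStep Φ u)^[n] 0 := by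
    intro n
    induction n with
    | zero => exact measurable_const
    | succ n ih =>
      simp only [Function.iterate_succ_apply']
      exact measurable_pi_iff.2 fun m => measurable_kernel_prefixPart (hΦ m) m ih
  exact h N

lemma triangular_kernelProcess {N : ℕ} (Φ : Fin N → (Fin N → ℝ) → ℝ → ℝ) :
    Triangular (kernelProcess Φ) := by
  intro k
  induction k using WellFoundedLT.induction with
  | ind k ih =>
    intro u v huv
    rw [kernelProcess_apply, kernelProcess_apply Φ v, huv k le_rfl,
      prefixPart_congr fun j hj => ih j hj u v fun i hi => huv i (hi.trans hj.le)]

lemma isQuantileProcess_kernelProcess {N : ℕ} {Φ : Fin N → (Fin N → ℝ) → ℝ → ℝ}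
    (hΦ : ∀ m, Measurable fun z : (Fin N → ℝ) × ℝ => Φ m z.1 z.2)
    (hmono : ∀ m x, MonotoneOn (Φ m x) (Ioo 0 1)) :
    IsQuantileProcess (kernelProcess Φ) where
  measurable := measurable_kernelProcess hΦ
  triangular := triangular_kernelProcess Φ
  inc k u hu v hv huv hk := by
    rw [kernelProcess_apply, kernelProcess_apply Φ v, prefixPart_congr fun j hj =>
      triangular_kernelProcess Φ j u v fun i hi => huv i (hi.trans_lt hj)]
    exact hmono k _ (hu k) (hv k) hk
  con k m _ u _ v _ huv hk := by
    induction m using WellFoundedLT.induction with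
    | ind m ih =>
      rcases lt_trichotomy m k with hmk | rfl | hmk
      · exact triangular_kernelProcess Φ m u v fun i hi => huv i (hi.trans_lt hmk).ne
      · exact hk
      · rw [kernelProcess_apply, kernelProcess_apply Φ v, huv m hmk.ne',
          prefixPart_congr fun j hj => ?_]
        rcases le_or_gt k j with hkj | hkj
        · exact ih j hj hkj
        · exact triangular_kernelProcess Φ j u v fun i hi => huv i (hi.trans_lt hkj).ne

/-! ### Limits of kernels -/

/-- The upper limit of a sequence of kernels. -/
noncomputable def limsupKernel {N : ℕ} (φ : ℕ → (Fin N → ℝ) → ℝ → ℝ) (x : Fin N → ℝ) (t : ℝ) :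
    EReal :=
  limsup (fun n => (φ n x t : EReal)) atTop

/-- The interval `(-π/2, π/2)` in the extended reals. -/
noncomputable def arctanRange : Set EReal :=
  Ioo ((-(Real.pi / 2) : ℝ) : EReal) ((Real.pi / 2 : ℝ) : EReal)

/-- The points at which the upper limit of the kernels takes values in the range of `arctan`. -/
def arctanBase {N : ℕ} (φ : ℕ → (Fin N → ℝ) → ℝ → ℝ) : Set (Fin N → ℝ) :=
  {x | ∀ q : ℚ, (q : ℝ) ∈ Ioo (0 : ℝ) 1 → limsupKernel φ x q ∈ arctanRange}

open scoped Classical in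
/-- The kernel whose arctangent is the upper limit of the given kernels. -/
noncomputable def tanKernel {N : ℕ} (φ : ℕ → (Fin N → ℝ) → ℝ → ℝ) (x : Fin N → ℝ) (t : ℝ) : ℝ :=
  if x ∈ arctanBase φ then Real.tan (limsupKernel φ x t).toReal else 0

section

variable {N : ℕ} {φ : ℕ → (Fin N → ℝ) → ℝ → ℝ}

lemma measurable_limsupKernel (hφ : ∀ n, IsRegularKernel (φ n)) :
    Measurable fun z : (Fin N → ℝ) × ℝ => limsupKernel φ z.1 z.2 :=
  Measurable.limsup fun n => measurable_coe_real_ereal.comp (hφ n).measurable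

lemma measurable_limsupKernel_left (hφ : ∀ n, IsRegularKernel (φ n)) (t : ℝ) :
    Measurable fun x : Fin N → ℝ => limsupKernel φ x t :=
  Measurable.limsup fun n =>
    measurable_coe_real_ereal.comp ((hφ n).measurable.comp measurable_prodMk_right)

lemma monotone_limsupKernel (hφ : ∀ n, IsRegularKernel (φ n)) (x : Fin N → ℝ) :
    Monotone (limsupKernel φ x) := fun _ _ hst =>
  limsup_le_limsup (Eventually.of_forall fun n => EReal.coe_le_coe_iff.2 ((hφ n).monotone x hst))

lemma measurableSet_arctanBase (hφ : ∀ n, IsRegularKernel (φ n)) :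
    MeasurableSet (arctanBase φ) := by
  have hrange : MeasurableSet arctanRange := measurableSet_Ioo
  have hmeas : ∀ q : ℚ, Measurable fun x : Fin N → ℝ => limsupKernel φ x q := fun q =>
    measurable_limsupKernel_left hφ q
  have heq : arctanBase φ = ⋂ q : ℚ, ⋂ _ : (q : ℝ) ∈ Ioo (0 : ℝ) 1,
      (fun x => limsupKernel φ x q) ⁻¹' arctanRange := by
    ext x; simp only [arctanBase, mem_ofPred_eq, mem_iInter, mem_preimage]
  rw [heq]
  exact MeasurableSet.iInter fun q => MeasurableSet.iInter fun _ => hmeas q hrange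

lemma limsupKernel_mem_arctanRange (hφ : ∀ n, IsRegularKernel (φ n)) {x : Fin N → ℝ}
    (hx : x ∈ arctanBase φ) {t : ℝ} (ht : t ∈ Ioo (0 : ℝ) 1) :
    limsupKernel φ x t ∈ arctanRange := by
  obtain ⟨q, hq0, hqt⟩ := exists_rat_btwn ht.1
  obtain ⟨r, htr, hr1⟩ := exists_rat_btwn ht.2
  exact ⟨(hx q ⟨hq0, hqt.trans ht.2⟩).1.trans_le (monotone_limsupKernel hφ x hqt.le),
    (monotone_limsupKernel hφ x htr.le).trans_lt (hx r ⟨ht.1.trans htr, hr1⟩).2⟩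

lemma toReal_mem_of_mem_arctanRange {y : EReal} (hy : y ∈ arctanRange) :
    y.toReal ∈ Ioo (-(Real.pi / 2)) (Real.pi / 2) := by
  have htop : y ≠ ⊤ := hy.2.ne_top
  have hbot : y ≠ ⊥ := hy.1.ne_bot
  lift y to ℝ using ⟨htop, hbot⟩
  exact ⟨EReal.coe_lt_coe_iff.1 hy.1, EReal.coe_lt_coe_iff.1 hy.2⟩

lemma measurable_tan : Measurable Real.tan := by
  have : Real.tan = fun x => Real.sin x / Real.cos x := funext Real.tan_eq_sin_div_cos
  rw [this]
  exact Real.measurable_sin.div Real.measurable_cos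

lemma measurable_tanKernel (hφ : ∀ n, IsRegularKernel (φ n)) :
    Measurable fun z : (Fin N → ℝ) × ℝ => tanKernel φ z.1 z.2 := by
  unfold tanKernel
  exact Measurable.ite (measurable_fst (measurableSet_arctanBase hφ))
    (measurable_tan.comp (measurable_ereal_toReal.comp (measurable_limsupKernel hφ)))
    measurable_const

lemma monotoneOn_tanKernel (hφ : ∀ n, IsRegularKernel (φ n)) (x : Fin N → ℝ) :
    MonotoneOn (tanKernel φ x) (Ioo 0 1) := by
  intro s hs t ht hst
  by_cases hx : x ∈ arctanBase φ
  · simp only [tanKernel, hx, if_true]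
    have hs' := limsupKernel_mem_arctanRange hφ hx hs
    have ht' := limsupKernel_mem_arctanRange hφ hx ht
    exact Real.strictMonoOn_tan.monotoneOn (toReal_mem_of_mem_arctanRange hs')
      (toReal_mem_of_mem_arctanRange ht')
      (EReal.toReal_le_toReal (monotone_limsupKernel hφ x hst) hs'.1.ne_bot ht'.2.ne_top)
  · simp [tanKernel, hx]

lemma mem_arctanBase_of_ae (hφ : ∀ n, IsRegularKernel (φ n)) {x : Fin N → ℝ}
    (h : ∀ᵐ t ∂lambda01, limsupKernel φ x t ∈ arctanRange) : x ∈ arctanBase φ := by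
  intro q hq
  obtain ⟨s, hs, hs'⟩ := exists_mem_Ioo_of_ae_lambda01 h hq.1 le_rfl hq.2.le
  obtain ⟨t, ht, ht'⟩ := exists_mem_Ioo_of_ae_lambda01 h hq.2 hq.1.le le_rfl
  exact ⟨hs'.1.trans_le (monotone_limsupKernel hφ x hs.2.le),
    (monotone_limsupKernel hφ x ht.1.le).trans_lt ht'.2⟩

lemma ae_limsupKernel_eq_arctan (hφ : ∀ n, IsRegularKernel (φ n)) (m : Fin N)
    {f : (Fin N → ℝ) → Fin N → ℝ} (hf : Measurable f)
    (hsum : ∑' n, kernelDist m (φ n) f ≠ ∞) :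
    ∀ᵐ u ∂lambdaN N, limsupKernel φ (prefixPart m (f u)) (u m) = Real.arctan (f u m) := by
  have hmeas := fun n => measurable_kernelDist_integrand (hφ n).measurable m hf
  simp only [kernelDist] at hsum
  rw [← lintegral_tsum fun n => (hmeas n).aemeasurable] at hsum
  filter_upwards [ae_lt_top (Measurable.tsum hmeas) hsum] with u hu
  have h0 := ENNReal.tendsto_atTop_zero_of_tsum_ne_top hu.ne
  have h1 : Tendsto (fun n => |Real.arctan (f u m) - φ n (prefixPart m (f u)) (u m)|) atTop
      (𝓝 0) := by
    have := (ENNReal.tendsto_toReal ENNReal.zero_ne_top).comp h0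
    simpa [Function.comp_def] using this
  have h2 : Tendsto (fun n => φ n (prefixPart m (f u)) (u m)) atTop (𝓝 (Real.arctan (f u m))) := by
    rw [tendsto_iff_dist_tendsto_zero]
    simpa [Real.dist_eq, abs_sub_comm] using h1
  exact (continuous_coe_real_ereal.tendsto _ |>.comp h2).limsup_eq

lemma arctan_mem_arctanRange (a : ℝ) : ((Real.arctan a : ℝ) : EReal) ∈ arctanRange :=
  ⟨EReal.coe_lt_coe_iff.2 (Real.neg_pi_div_two_lt_arctan a),
    EReal.coe_lt_coe_iff.2 (Real.arctan_lt_pi_div_two a)⟩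

end

lemma exists_isQuantileProcess_of_kernelDist {N : ℕ} {f : (Fin N → ℝ) → Fin N → ℝ}
    (hf : Measurable f) {φ : Fin N → ℕ → (Fin N → ℝ) → ℝ → ℝ}
    (hφ : ∀ m n, IsRegularKernel (φ m n)) (hsum : ∀ m, ∑' n, kernelDist m (φ m n) f ≠ ∞) :
    ∃ Q : (Fin N → ℝ) → Fin N → ℝ, IsQuantileProcess Q ∧ f =ᵐ[lambdaN N] Q := by
  set Q := kernelProcess fun m => tanKernel (φ m) with hQ
  refine ⟨Q, isQuantileProcess_kernelProcess (fun m => measurable_tanKernel (hφ m))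
    fun m => monotoneOn_tanKernel (hφ m), ?_⟩
  suffices h : ∀ m, ∀ᵐ u ∂lambdaN N, f u m = Q u m by
    filter_upwards [ae_all_iff.2 h] with u hu using funext hu
  intro m
  induction m using WellFoundedLT.induction with
  | ind m ih =>
    have hprev : ∀ᵐ u ∂lambdaN N, prefixPart m (f u) = prefixPart m (Q u) := by
      filter_upwards [ae_all_iff.2 fun j => ae_all_iff.2 fun hj : j < m => ih j hj] with u hu
      exact prefixPart_congr hu
    have hlim : ∀ᵐ u ∂lambdaN N,
        limsupKernel (φ m) (prefixPart m (Q u)) (u m) = Real.arctan (f u m) := by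
      filter_upwards [hprev, ae_limsupKernel_eq_arctan (hφ m) m hf (hsum m)] with u h1 h2
      rw [← h1, h2]
    have hbase : ∀ᵐ u ∂lambdaN N, prefixPart m (Q u) ∈ arctanBase (φ m) := by
      filter_upwards [ae_ae_update_of_ae m hlim] with u hu
      refine mem_arctanBase_of_ae (hφ m) (hu.mono fun t ht => ?_)
      have hpre : prefixPart m (Q (Function.update u m t)) = prefixPart m (Q u) :=
        prefixPart_congr fun j hj => triangular_kernelProcess _ j _ _ fun i hi =>
          Function.update_of_ne (hi.trans_lt hj).ne _ _
      rw [hpre, Function.update_self] at ht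
      rw [ht]
      exact arctan_mem_arctanRange _
    filter_upwards [hlim, hbase] with u h1 h2
    rw [hQ, kernelProcess_apply, ← hQ, tanKernel, if_pos h2, h1, EReal.toReal_coe,
      Real.tan_arctan]

/-! ### Quantile processes are generated by kernels -/

/-- By consistency, a component of a quantile process is determined by the earlier components and
the current coordinate. -/
lemma IsQuantileProcess.apply_eq_of_prefix_eq {N : ℕ} {Q : (Fin N → ℝ) → Fin N → ℝ}
    (hQ : IsQuantileProcess Q) {m : Fin N} {u v : Fin N → ℝ} (hu : u ∈ cube N) (hv : v ∈ cube N)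
    (hlt : ∀ j < m, Q u j = Q v j) (hm : u m = v m) : Q u m = Q v m := by
  set w : ℕ → Fin N → ℝ := fun k j => if (j : ℕ) < k then v j else u j with hw
  have hcube : ∀ k, w k ∈ cube N := fun k j => by
    by_cases h : (j : ℕ) < k <;> simp only [hw, h, if_true, if_false]
    exacts [hv j, hu j]
  have hconst : ∀ k, k ≤ (m : ℕ) → ∀ j, Q (w k) j = Q u j := by
    intro k
    induction k with
    | zero => intro _ j; simp [hw]
    | succ k ih =>
      intro hk
      have ih := ih (by omega)
      let i : Fin N := ⟨k, by omega⟩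
      have him : i < m := Fin.lt_def.2 (by simp only [i]; omega)
      have hne : ∀ j ≠ i, w k j = w (k + 1) j := fun j hj => by
        have : (j : ℕ) ≠ k := fun h => hj (Fin.ext h)
        have : (j : ℕ) < k ↔ (j : ℕ) < k + 1 := by omega
        simp only [hw, this]
      have hi : Q (w k) i = Q (w (k + 1)) i := by
        rw [ih i, hlt i him]
        refine (hQ.triangular i _ _ fun j hj => ?_).symm
        have : (j : ℕ) < k + 1 := Nat.lt_succ_of_le (Fin.le_def.1 hj)
        simp only [hw, this, if_true]
      intro j
      rw [← ih j]
      rcases lt_or_ge j i with hj | hj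
      · exact hQ.triangular j _ _ fun l hl => (hne l (hl.trans_lt hj).ne).symm
      · exact (hQ.con i j hj _ (hcube k) _ (hcube (k + 1)) hne hi).symm
  rw [← hconst m le_rfl m]
  refine hQ.triangular m _ _ fun j hj => ?_
  rcases hj.lt_or_eq with h | rfl
  · have : (j : ℕ) < m := h
    simp only [hw, this, if_true]
  · simpa [hw] using hm

/-- A measurable function that is constant on the fibres of a measurable map factors measurably
through it, over a standard Borel space. -/
lemma exists_measurable_eq_comp_of_fibers {α β : Type*} [MeasurableSpace α]
    [StandardBorelSpace α] [MeasurableSpace β] [StandardBorelSpace β] {X : α → β} {H : α → ℝ}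
    (hX : Measurable X) (hH : Measurable H) (h : ∀ a b, X a = X b → H a = H b) :
    ∃ γ : β → ℝ, Measurable γ ∧ ∀ a, H a = γ (X a) := by
  have hcomap : Measurable[MeasurableSpace.comap X inferInstance] H := by
    intro s hs
    have hpre : X ⁻¹' (X '' (H ⁻¹' s)) = H ⁻¹' s := by
      refine Subset.antisymm ?_ (subset_preimage_image _ _)
      rintro a ⟨b, hb, hab⟩
      simpa only [mem_preimage, h b a hab] using hb
    have hval := (hX.measurableSet_preimage_iff_preimage_val (s := X '' (H ⁻¹' s))).1
      (by rw [hpre]; exact hH hs)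
    obtain ⟨t, ht, hteq⟩ := hval
    refine ⟨t, ht, ?_⟩
    rw [← hpre]
    ext a
    exact Set.ext_iff.1 hteq ⟨X a, mem_range_self a⟩
  obtain ⟨γ, hγ, heq⟩ := hcomap.exists_eq_measurable_comp
  exact ⟨γ, hγ, fun a => congrFun heq a⟩

lemma measurableSet_cube (N : ℕ) : MeasurableSet (cube N) := by
  have : cube N = univ.pi fun _ => Ioo (0 : ℝ) 1 := by ext u; simp [cube]
  rw [this]
  exact MeasurableSet.univ_pi fun _ => measurableSet_Ioo

lemma update_mem_cube {N : ℕ} {u : Fin N → ℝ} (hu : u ∈ cube N) (m : Fin N) {s : ℝ}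
    (hs : s ∈ Ioo (0 : ℝ) 1) : Function.update u m s ∈ cube N := fun j => by
  by_cases h : j = m
  · subst h; simpa using hs
  · simpa [h] using hu j

lemma IsQuantileProcess.exists_factor {N : ℕ} {Q : (Fin N → ℝ) → Fin N → ℝ}
    (hQ : IsQuantileProcess Q) (m : Fin N) {s : ℝ} (hs : s ∈ Ioo (0 : ℝ) 1) :
    ∃ γ : (Fin N → ℝ) → ℝ, Measurable γ ∧ ∀ u ∈ cube N,
      Real.arctan (Q (Function.update u m s) m) = γ (prefixPart m (Q u)) := by
  have := (measurableSet_cube N).standardBorel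
  have hupd : Measurable fun u : Fin N → ℝ => Function.update u m s := measurable_update_left
  have hval : Measurable (Subtype.val : cube N → Fin N → ℝ) := measurable_subtype_coe
  obtain ⟨γ, hγ, h⟩ := exists_measurable_eq_comp_of_fibers
    (X := fun u : cube N => prefixPart m (Q u))
    (H := fun u : cube N => Real.arctan (Q (Function.update u m s) m))
    ((measurable_prefixPart m).comp (hQ.measurable.comp hval))
    (Real.measurable_arctan.comp ((hQ.measurable.comp (hupd.comp hval)).eval))
    (fun u v huv => by
      have hQj : ∀ u : Fin N → ℝ, ∀ j < m, Q (Function.update u m s) j = Q u j := fun u j hj =>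
        hQ.triangular j _ _ fun i hi => Function.update_of_ne (hi.trans_lt hj).ne _ _
      have := hQ.apply_eq_of_prefix_eq (m := m) (update_mem_cube u.2 m hs)
        (update_mem_cube v.2 m hs)
        (fun j hj => by rw [hQj _ j hj, hQj _ j hj, eq_of_prefixPart_eq huv j hj])
        (by simp)
      simp only [this])
  exact ⟨γ, hγ, fun u hu => h ⟨u, hu⟩⟩

/-! ### Discretization of the last coordinate -/

/-- The points `(i + 1/2) / (K + 1)`. -/
noncomputable def gridPoint (K i : ℕ) : ℝ := (i + 1 / 2) / (K + 1)

lemma gridPoint_mem_Ioo {K i : ℕ} (h : i ≤ K) : gridPoint K i ∈ Ioo (0 : ℝ) 1 := by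
  have hK : (0 : ℝ) < K + 1 := by positivity
  refine ⟨by unfold gridPoint; positivity, ?_⟩
  rw [gridPoint, div_lt_one hK]
  have : (i : ℝ) ≤ K := by exact_mod_cast h
  linarith

lemma gridPoint_mono (K : ℕ) : Monotone (gridPoint K) := fun i j hij => by
  unfold gridPoint; gcongr

lemma floor_mul_lt {K : ℕ} (hK : 0 < K) {t : ℝ} (ht : t ∈ Ioo (0 : ℝ) 1) :
    ⌊(K : ℝ) * t⌋₊ < K := by
  have hK' : (0 : ℝ) < K := by exact_mod_cast hK
  rw [Nat.floor_lt (mul_nonneg hK'.le ht.1.le)]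
  nlinarith [ht.2]

lemma gridPoint_floor_mem_Ioo (K : ℕ) {t : ℝ} (ht : t ∈ Ioo (0 : ℝ) 1) :
    gridPoint K ⌊(K : ℝ) * t⌋₊ ∈ Ioo (0 : ℝ) 1 := by
  rcases Nat.eq_zero_or_pos K with rfl | hK
  · exact gridPoint_mem_Ioo (by simp)
  · exact gridPoint_mem_Ioo (floor_mul_lt hK ht).le

lemma tendsto_gridPoint_floor {t : ℝ} (ht : t ∈ Ioo (0 : ℝ) 1) :
    Tendsto (fun K : ℕ => gridPoint K ⌊(K : ℝ) * t⌋₊) atTop (𝓝 t) := by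
  rw [tendsto_iff_dist_tendsto_zero]
  have hlim : Tendsto (fun K : ℕ => 2 * (1 / ((K : ℝ) + 1))) atTop (𝓝 0) := by
    simpa using tendsto_one_div_add_atTop_nhds_zero_nat.const_mul (2 : ℝ)
  refine squeeze_zero (fun _ => dist_nonneg) (fun K => ?_) hlim
  have hK : (0 : ℝ) < K + 1 := by positivity
  have h0 : 0 ≤ (K : ℝ) * t := mul_nonneg (by positivity) ht.1.le
  have h1 := Nat.floor_le h0
  have h2 := Nat.lt_floor_add_one ((K : ℝ) * t)
  have heq : gridPoint K ⌊(K : ℝ) * t⌋₊ - t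
      = ((⌊(K : ℝ) * t⌋₊ : ℝ) + 1 / 2 - K * t - t) / (K + 1) := by
    unfold gridPoint; field_simp; ring
  rw [Real.dist_eq, heq, abs_div, abs_of_pos hK, mul_one_div]
  gcongr
  rw [abs_le]
  constructor <;> linarith [ht.1, ht.2]

lemma measurable_gridPoint_floor (K : ℕ) :
    Measurable fun t : ℝ => gridPoint K ⌊(K : ℝ) * t⌋₊ := by
  have h1 : Measurable fun t : ℝ => ⌊(K : ℝ) * t⌋₊ :=
    Nat.measurable_floor.comp (measurable_const.mul measurable_id)
  exact (measurable_of_countable (gridPoint K)).comp h1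

lemma IsQuantileProcess.tendsto_lintegral_grid {N : ℕ} {Q : (Fin N → ℝ) → Fin N → ℝ}
    (hQ : IsQuantileProcess Q) (m : Fin N) :
    Tendsto (fun K : ℕ => ∫⁻ u, ENNReal.ofReal |Real.arctan (Q u m) - Real.arctan
      (Q (Function.update u m (gridPoint K ⌊(K : ℝ) * u m⌋₊)) m)| ∂lambdaN N) atTop (𝓝 0) := by
  have hh : Measurable fun u => Real.arctan (Q u m) :=
    Real.measurable_arctan.comp hQ.measurable.eval
  have hgrid : ∀ K : ℕ, Measurable fun u : Fin N → ℝ =>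
      Real.arctan (Q (Function.update u m (gridPoint K ⌊(K : ℝ) * u m⌋₊)) m) := fun K => by
    have hupd : Measurable fun u : Fin N → ℝ =>
        Function.update u m (gridPoint K ⌊(K : ℝ) * u m⌋₊) :=
      (measurable_update' (a := m)).comp
        (measurable_id.prodMk ((measurable_gridPoint_floor K).comp (measurable_pi_apply m)))
    exact hh.comp hupd
  have hae : ∀ᵐ u ∂lambdaN N, Tendsto (fun K : ℕ => Real.arctan
      (Q (Function.update u m (gridPoint K ⌊(K : ℝ) * u m⌋₊)) m)) atTop
      (𝓝 (Real.arctan (Q u m))) := by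
    refine ae_of_ae_ae_update m (measurableSet_tendsto_fun hgrid hh) ?_
    filter_upwards [ae_lambdaN_mem_cube N] with u hu
    set g : ℝ → ℝ := fun t => Real.arctan (Q (Function.update u m t) m) with hg
    have hmono : MonotoneOn g (Ioo 0 1) := fun s hs t ht hst => by
      refine Real.arctan_mono (hQ.inc m _ (update_mem_cube hu m hs) _ (update_mem_cube hu m ht)
        (fun j hj => ?_) (by simpa using hst))
      rw [Function.update_of_ne hj.ne, Function.update_of_ne hj.ne]
    have hcount : ∀ᵐ t ∂lambda01, ¬(t ∈ Ioo (0 : ℝ) 1 ∧ ¬ContinuousWithinAt g (Ioo 0 1) t) := by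
      refine ae_restrict_of_ae ?_
      exact hmono.countable_not_continuousWithinAt.ae_notMem volume
    filter_upwards [hcount, ae_lambda01_mem_Ioo] with t h1 ht
    have hcont : ContinuousWithinAt g (Ioo 0 1) t := by
      by_contra hne
      exact h1 ⟨ht, hne⟩
    have hlim : Tendsto (fun K : ℕ => gridPoint K ⌊(K : ℝ) * t⌋₊) atTop (𝓝[Ioo 0 1] t) :=
      tendsto_nhdsWithin_iff.2 ⟨tendsto_gridPoint_floor ht,
        Eventually.of_forall fun K => gridPoint_floor_mem_Ioo K ht⟩
    simpa [hg, Function.comp_def] using hcont.tendsto.comp hlim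
  have hdom := tendsto_lintegral_of_dominated_convergence (μ := lambdaN N)
    (F := fun K u => ENNReal.ofReal |Real.arctan (Q u m) - Real.arctan
      (Q (Function.update u m (gridPoint K ⌊(K : ℝ) * u m⌋₊)) m)|)
    (f := fun _ => 0) (fun _ => ENNReal.ofReal 4)
    (fun K => ENNReal.measurable_ofReal.comp (continuous_abs.measurable.comp (hh.sub (hgrid K))))
    (fun K => Eventually.of_forall fun u => ENNReal.ofReal_le_ofReal
      ((abs_sub _ _).trans (by
        linarith [abs_arctan_le_two (Q u m), abs_arctan_le_two
          (Q (Function.update u m (gridPoint K ⌊(K : ℝ) * u m⌋₊)) m)])))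
    (by simp) ?_
  · simpa using hdom
  · filter_upwards [hae] with u hu
    have h1 : Tendsto (fun K : ℕ => |Real.arctan (Q u m) - Real.arctan
        (Q (Function.update u m (gridPoint K ⌊(K : ℝ) * u m⌋₊)) m)|) atTop (𝓝 0) := by
      simpa using (hu.const_sub (Real.arctan (Q u m))).abs
    simpa [Function.comp_def] using (ENNReal.continuous_ofReal.tendsto 0).comp h1

/-! ### Approximation by regular kernels -/

lemma exists_weight {N : ℕ} {X : (Fin N → ℝ) → Fin N → ℝ} (hX : Measurable X)
    {d : (Fin N → ℝ) → ℝ} (hd : Measurable d) {B : ℝ}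
    (hd0 : ∀ᵐ u ∂lambdaN N, d (X u) ∈ Icc 0 B) {ε : ℝ≥0∞} (hε : ε ≠ 0) :
    ∃ w : (Fin N → ℝ) → ℝ, UniformContinuous w ∧ (∀ x, 0 ≤ w x) ∧ (∃ C, ∀ x, w x ≤ C) ∧
      ∫⁻ u, ENNReal.ofReal |d (X u) - w (X u)| ∂lambdaN N ≤ ε := by
  have hint : Integrable d ((lambdaN N).map X) := by
    rw [integrable_map_measure hd.aestronglyMeasurable hX.aemeasurable]
    refine Integrable.of_bound (hd.comp hX).aestronglyMeasurable B ?_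
    filter_upwards [hd0] with u hu
    rw [Function.comp_apply, Real.norm_of_nonneg hu.1]
    exact hu.2
  have : IsProbabilityMeasure ((lambdaN N).map X) :=
    Measure.isProbabilityMeasure_map hX.aemeasurable
  obtain ⟨g, hgc, hgε, hg, -⟩ := hint.exists_hasCompactSupport_lintegral_sub_le hε
  obtain ⟨C, hC⟩ := hgc.exists_bound_of_continuous hg
  have hC0 : 0 ≤ C := (norm_nonneg _).trans (hC 0)
  refine ⟨fun x => max (g x) 0, ?_, fun x => le_max_right _ _,
    ⟨C, fun x => max_le ((le_abs_self _).trans (hC x)) hC0⟩, ?_⟩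
  · exact (LipschitzWith.id.max_const 0).uniformContinuous.comp
      (hgc.uniformContinuous_of_continuous hg)
  · have hm : Measurable fun x => ‖d x - g x‖ₑ := (hd.sub hg.measurable).enorm
    rw [lintegral_map hm hX] at hgε
    refine (lintegral_mono_ae ?_).trans hgε
    filter_upwards [hd0] with u hu
    rw [Real.enorm_eq_ofReal_abs]
    refine ENNReal.ofReal_le_ofReal ?_
    have := abs_max_sub_max_le_abs (d (X u)) (g (X u)) 0
    rwa [max_eq_left hu.1] at this

/-- The values of `arctan (Q · m)` on the grid, preceded by the lower bound `-2`. -/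
noncomputable def gridValue {N : ℕ} (Q : (Fin N → ℝ) → Fin N → ℝ) (m : Fin N) (K : ℕ)
    (u : Fin N → ℝ) : ℕ → ℝ
  | 0 => -2
  | i + 1 => Real.arctan (Q (Function.update u m (gridPoint K i)) m)

lemma sum_range_sub_mul_ite (a : ℕ → ℝ) {n K : ℕ} (h : n < K) :
    ∑ i ∈ Finset.range K, (a (i + 1) - a i) * (if i ≤ n then 1 else 0) = a (n + 1) - a 0 := by
  rw [← Finset.sum_range_sub]
  simp only [mul_ite, mul_one, mul_zero]
  rw [← Finset.sum_filter]
  refine Finset.sum_congr ?_ fun _ _ => rfl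
  ext i
  simp only [Finset.mem_filter, Finset.mem_range]
  omega

lemma IsQuantileProcess.gridValue_sub_mem_Icc {N : ℕ} {Q : (Fin N → ℝ) → Fin N → ℝ}
    (hQ : IsQuantileProcess Q) (m : Fin N) {K i : ℕ} (hi : i ≤ K) {u : Fin N → ℝ}
    (hu : u ∈ cube N) : gridValue Q m K u (i + 1) - gridValue Q m K u i ∈ Icc (0 : ℝ) 4 := by
  cases i with
  | zero =>
    have := abs_le.1 (abs_arctan_le_two (Q (Function.update u m (gridPoint K 0)) m))
    simp only [gridValue]
    constructor <;> linarith
  | succ i =>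
    have h1 := abs_le.1 (abs_arctan_le_two (Q (Function.update u m (gridPoint K (i + 1))) m))
    have h2 := abs_le.1 (abs_arctan_le_two (Q (Function.update u m (gridPoint K i)) m))
    have h3 : Q (Function.update u m (gridPoint K i)) m
        ≤ Q (Function.update u m (gridPoint K (i + 1))) m := by
      refine hQ.inc m _ (update_mem_cube hu m (gridPoint_mem_Ioo (by omega))) _
        (update_mem_cube hu m (gridPoint_mem_Ioo hi)) (fun j hj => ?_)
        (by simpa using gridPoint_mono K (Nat.le_succ i))
      rw [Function.update_of_ne hj.ne, Function.update_of_ne hj.ne]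
    have h4 := Real.arctan_mono h3
    simp only [gridValue]
    constructor <;> linarith

lemma IsQuantileProcess.exists_gridValue_factor {N : ℕ} {Q : (Fin N → ℝ) → Fin N → ℝ}
    (hQ : IsQuantileProcess Q) (m : Fin N) {K i : ℕ} (hi : i ≤ K + 1) :
    ∃ γ : (Fin N → ℝ) → ℝ, Measurable γ ∧ ∀ u ∈ cube N,
      gridValue Q m K u i = γ (prefixPart m (Q u)) := by
  cases i with
  | zero => exact ⟨fun _ => -2, measurable_const, fun u _ => rfl⟩
  | succ i => exact hQ.exists_factor m (gridPoint_mem_Ioo (by omega))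

lemma IsQuantileProcess.exists_grid_weight {N : ℕ} {Q : (Fin N → ℝ) → Fin N → ℝ}
    (hQ : IsQuantileProcess Q) (m : Fin N) {K i : ℕ} (hi : i ≤ K) {ε : ℝ≥0∞} (hε : ε ≠ 0) :
    ∃ w : (Fin N → ℝ) → ℝ, UniformContinuous w ∧ (∀ x, 0 ≤ w x) ∧ (∃ C, ∀ x, w x ≤ C) ∧
      ∫⁻ u, ENNReal.ofReal |gridValue Q m K u (i + 1) - gridValue Q m K u i
        - w (prefixPart m (Q u))| ∂lambdaN N ≤ ε := by
  obtain ⟨γ, hγ, h⟩ := hQ.exists_gridValue_factor m (show i ≤ K + 1 by omega)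
  obtain ⟨γ', hγ', h'⟩ := hQ.exists_gridValue_factor m (show i + 1 ≤ K + 1 by omega)
  obtain ⟨w, hw, hw0, hwC, hwε⟩ := exists_weight
    (X := fun u => prefixPart m (Q u)) ((measurable_prefixPart m).comp hQ.measurable)
    (d := fun x => γ' x - γ x) (hγ'.sub hγ) (B := 4)
    ((ae_lambdaN_mem_cube N).mono fun u hu => by
      rw [← h u hu, ← h' u hu]; exact hQ.gridValue_sub_mem_Icc m hi hu) hε
  refine ⟨w, hw, hw0, hwC, (lintegral_congr_ae ?_).trans_le hwε⟩
  filter_upwards [ae_lambdaN_mem_cube N] with u hu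
  rw [h u hu, h' u hu]

lemma IsQuantileProcess.exists_kernelDist_lt {N : ℕ} {Q : (Fin N → ℝ) → Fin N → ℝ}
    (hQ : IsQuantileProcess Q) (m : Fin N) {ε : ℝ≥0∞} (hε : 0 < ε) :
    ∃ φ : (Fin N → ℝ) → ℝ → ℝ, IsRegularKernel φ ∧ kernelDist m φ Q < ε := by
  obtain ⟨K, hKε, hK⟩ := (((hQ.tendsto_lintegral_grid m).eventually_lt_const
    (ENNReal.half_pos hε.ne')).and (eventually_gt_atTop 0)).exists
  obtain ⟨δ, hδ, hδε⟩ := ENNReal.exists_pos_sum_of_countable (ENNReal.half_pos hε.ne').ne' ℕ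
  choose! w hw hw0 hwC hwδ using fun (i : ℕ) (hi : i ≤ K) =>
    hQ.exists_grid_weight m hi (ε := δ i) (by simpa using (hδ i).ne')
  set σ : ℕ → ℝ → ℝ := fun i t => if i ≤ ⌊(K : ℝ) * t⌋₊ then 1 else 0 with hσ
  have hσmono : ∀ i, Monotone (σ i) := fun i s t hst => by
    have : ⌊(K : ℝ) * s⌋₊ ≤ ⌊(K : ℝ) * t⌋₊ := Nat.floor_mono (by gcongr)
    simp only [hσ]
    split_ifs <;> first | omega | norm_num
  have hσ0 : ∀ i t, 0 ≤ σ i t := fun i t => by simp only [hσ]; split_ifs <;> norm_num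
  have hσ1 : ∀ i t, σ i t ≤ 1 := fun i t => by simp only [hσ]; split_ifs <;> norm_num
  set φ : (Fin N → ℝ) → ℝ → ℝ := fun x t => -2 + ∑ i ∈ Finset.range K, w i x * σ i t with hφ
  have hreg : IsRegularKernel φ := by
    refine (isRegularKernel_const (-2)).add (IsRegularKernel.sum _ fun i hi => ?_)
    have hi := (Finset.mem_range.1 hi).le
    obtain ⟨C, hC⟩ := hwC i hi
    exact isRegularKernel_mul (hw i hi) (hw0 i hi) hC (hσmono i) (hσ0 i) (hσ1 i)
  refine ⟨φ, hreg, ?_⟩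
  have hval : ∀ i, Measurable fun u => gridValue Q m K u i := fun i => by
    cases i with
    | zero => exact measurable_const
    | succ i =>
      have hupd : Measurable fun u : Fin N → ℝ => Function.update u m (gridPoint K i) :=
        measurable_update_left
      exact Real.measurable_arctan.comp (hQ.measurable.comp hupd).eval
  have hdiff : ∀ i ∈ Finset.range K, Measurable fun u => ENNReal.ofReal
      |gridValue Q m K u (i + 1) - gridValue Q m K u i - w i (prefixPart m (Q u))| := by
    intro i hi
    have h1 := (hw i (Finset.mem_range.1 hi).le).continuous.measurable.comp
      ((measurable_prefixPart m).comp hQ.measurable)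
    exact ENNReal.measurable_ofReal.comp
      (continuous_abs.measurable.comp (((hval (i + 1)).sub (hval i)).sub h1))
  have hpt : ∀ u ∈ cube N,
      ENNReal.ofReal |Real.arctan (Q u m) - φ (prefixPart m (Q u)) (u m)|
      ≤ ENNReal.ofReal |Real.arctan (Q u m) - Real.arctan
          (Q (Function.update u m (gridPoint K ⌊(K : ℝ) * u m⌋₊)) m)|
        + ∑ i ∈ Finset.range K, ENNReal.ofReal
          |gridValue Q m K u (i + 1) - gridValue Q m K u i - w i (prefixPart m (Q u))| := by
    intro u hu
    rw [← ENNReal.ofReal_sum_of_nonneg fun _ _ => abs_nonneg _,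
      ← ENNReal.ofReal_add (abs_nonneg _) (Finset.sum_nonneg fun _ _ => abs_nonneg _)]
    refine ENNReal.ofReal_le_ofReal ?_
    have htel := sum_range_sub_mul_ite (gridValue Q m K u) (floor_mul_lt hK (hu m))
    have hsplit : Real.arctan (Q u m) - φ (prefixPart m (Q u)) (u m)
        = (Real.arctan (Q u m) - Real.arctan
          (Q (Function.update u m (gridPoint K ⌊(K : ℝ) * u m⌋₊)) m))
        + ∑ i ∈ Finset.range K,
          (gridValue Q m K u (i + 1) - gridValue Q m K u i - w i (prefixPart m (Q u)))
            * σ i (u m) := by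
      simp only [hφ, hσ, sub_mul _ (w _ _), Finset.sum_sub_distrib, htel]
      simp only [gridValue]
      ring
    rw [hsplit]
    refine (abs_add_le _ _).trans (add_le_add_right ?_ _)
    refine (Finset.abs_sum_le_sum_abs _ _).trans (Finset.sum_le_sum fun i _ => ?_)
    rw [abs_mul, abs_of_nonneg (hσ0 _ _)]
    exact mul_le_of_le_one_right (abs_nonneg _) (hσ1 _ _)
  calc kernelDist m φ Q
      ≤ ∫⁻ u, (ENNReal.ofReal |Real.arctan (Q u m) - Real.arctan
          (Q (Function.update u m (gridPoint K ⌊(K : ℝ) * u m⌋₊)) m)|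
        + ∑ i ∈ Finset.range K, ENNReal.ofReal
          |gridValue Q m K u (i + 1) - gridValue Q m K u i - w i (prefixPart m (Q u))|)
          ∂lambdaN N := lintegral_mono_ae ((ae_lambdaN_mem_cube N).mono hpt)
    _ = ∫⁻ u, ENNReal.ofReal |Real.arctan (Q u m) - Real.arctan
          (Q (Function.update u m (gridPoint K ⌊(K : ℝ) * u m⌋₊)) m)| ∂lambdaN N
        + ∑ i ∈ Finset.range K, ∫⁻ u, ENNReal.ofReal
          |gridValue Q m K u (i + 1) - gridValue Q m K u i - w i (prefixPart m (Q u))|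
          ∂lambdaN N := by
        rw [lintegral_add_right _ (Finset.measurable_fun_sum _ hdiff),
          lintegral_finsetSum _ hdiff]
    _ ≤ ∫⁻ u, ENNReal.ofReal |Real.arctan (Q u m) - Real.arctan
          (Q (Function.update u m (gridPoint K ⌊(K : ℝ) * u m⌋₊)) m)| ∂lambdaN N
        + ∑ i ∈ Finset.range K, (δ i : ℝ≥0∞) := by
        gcongr with i hi
        exact hwδ i (Finset.mem_range.1 hi).le
    _ < ε / 2 + ε / 2 := ENNReal.add_lt_add hKε ((ENNReal.sum_le_tsum _).trans_lt hδε)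
    _ = ε := ENNReal.add_halves ε

/-- The set `L^quantile_p(λ^N) = {Q^μ : μ ∈ P_p(ℝ^N)}` is a `G_δ` subset of
`L_p(λ^N; ℝ^N)`: there is a countable family of subsets of `L_p(λ^N; ℝ^N)` (sets of
`p`-integrable measurable maps, saturated under a.e. equality and open for the `L_p`
distance) whose intersection is exactly the set of (classes of) `p`-integrable quantile
processes. -/
theorem Lquantile_Gdelta (N : ℕ) (p : ℝ) (hp : p = 0 ∨ 1 ≤ p) :
    ∃ U : ℕ → Set ((Fin N → ℝ) → Fin N → ℝ),
      (∀ n, ∀ f ∈ U n, Measurable f ∧ FinLp p f) ∧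
      (∀ n, ∀ f ∈ U n, ∃ ε : ℝ≥0∞, 0 < ε ∧
        ∀ g : (Fin N → ℝ) → Fin N → ℝ,
          Measurable g → FinLp p g → Ldist p f g < ε → g ∈ U n) ∧
      (∀ (n : ℕ) (f g : (Fin N → ℝ) → Fin N → ℝ), f ∈ U n →
        Measurable g → FinLp p g → f =ᵐ[lambdaN N] g → g ∈ U n) ∧
      (∀ f : (Fin N → ℝ) → Fin N → ℝ, Measurable f → FinLp p f →
        ((∀ n, f ∈ U n) ↔
          ∃ Q : (Fin N → ℝ) → Fin N → ℝ, IsQuantileProcess Q ∧ f =ᵐ[lambdaN N] Q)) := by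
  let c : ℕ → ℝ≥0∞ := fun n => 2⁻¹ ^ n
  have hc : ∀ n, 0 < c n := fun n => ENNReal.pow_pos (by simp) n
  have hcsum : ∑' n, c n ≠ ∞ := by simp [c, ENNReal.tsum_geometric]
  have hopen : ∀ n, ∀ f : (Fin N → ℝ) → Fin N → ℝ, Measurable f →
      (∀ m, ∃ φ, IsRegularKernel φ ∧ kernelDist m φ f < c n) → ∃ ε : ℝ≥0∞, 0 < ε ∧
        ∀ g : (Fin N → ℝ) → Fin N → ℝ, Measurable g → Ldist p f g < ε →
          ∀ m, ∃ φ, IsRegularKernel φ ∧ kernelDist m φ g < c n := by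
    intro n f hf hφ
    choose φ hφ hdist using hφ
    choose η hη hlt using fun m => exists_kernelDist_lt (hφ m) m hf (hdist m)
    obtain ⟨ε, hε, h⟩ := exists_lintegral_cost0_lt_of_Ldist_lt (N := N) hp
      (η := Finset.univ.inf η) ((Finset.lt_inf_iff (by simp)).2 fun m _ => hη m)
    exact ⟨ε, hε, fun g hg hfg m => ⟨φ m, hφ m,
      hlt m g hg ((h f g hfg).trans_le (Finset.inf_le (Finset.mem_univ m)))⟩⟩
  refine ⟨fun n => {f | (Measurable f ∧ FinLp p f) ∧
    ∀ m, ∃ φ, IsRegularKernel φ ∧ kernelDist m φ f < c n}, fun n f hf => hf.1, ?_, ?_, ?_⟩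
  · rintro n f ⟨⟨hf, -⟩, hφ⟩
    obtain ⟨ε, hε, h⟩ := hopen n f hf hφ
    exact ⟨ε, hε, fun g hg hg' hfg => ⟨⟨hg, hg'⟩, h g hg hfg⟩⟩
  · rintro n f g ⟨-, hφ⟩ hg hg' hfg
    refine ⟨⟨hg, hg'⟩, fun m => ?_⟩
    obtain ⟨φ, hφ, hlt⟩ := hφ m
    exact ⟨φ, hφ, by rwa [← kernelDist_congr_ae m φ hfg]⟩
  · intro f hf hf'
    constructor
    · intro h
      choose φ hφ hlt using fun m n => (h n).2 m
      exact exists_isQuantileProcess_of_kernelDist hf hφ fun m =>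
        ne_top_of_le_ne_top hcsum (ENNReal.tsum_le_tsum fun n => (hlt m n).le)
    · rintro ⟨Q, hQ, hfQ⟩ n
      refine ⟨⟨hf, hf'⟩, fun m => ?_⟩
      obtain ⟨φ, hφ, hlt⟩ := hQ.exists_kernelDist_lt m (hc n)
      exact ⟨φ, hφ, by rwa [kernelDist_congr_ae m φ hfQ]⟩
end

section
/- If T, S : (0,1)^N → ℝ^N are Borel triangular maps each satisfying the monotonicity condition (inc) and the consistency condition (con), and α ∈ (0,1), then the map (1−α)T + αS also satisfies (inc) and (con). Consequently, for every p ∈ {0} ∪ [1,∞), the sets L^quantile_p(λ^N), L^SIT_p(λ^N) and L^IT_p(λ^N) are convex cones in L_p(λ^N; ℝ^N). -/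
open MeasureTheory ProbabilityTheory Filter Set
open scoped ENNReal NNReal Topology

/-- An increasing triangular transformation: a Borel triangular map satisfying (inc) on a
`λ^N`-full subset of the unit cube. -/
def IncreasingTriangular {N : ℕ} (T : (Fin N → ℝ) → Fin N → ℝ) : Prop :=
  Measurable T ∧ Triangular T ∧
    ∃ Γ : Set (Fin N → ℝ), Γ ⊆ cube N ∧ lambdaN N Γᶜ = 0 ∧ IncOn T Γ

/-- A strictly increasing triangular transformation: a Borel triangular map satisfying (sinc)
on a `λ^N`-full subset of the unit cube. -/
def StrictlyIncreasingTriangular {N : ℕ} (T : (Fin N → ℝ) → Fin N → ℝ) : Prop :=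
  Measurable T ∧ Triangular T ∧
    ∃ Γ : Set (Fin N → ℝ), Γ ⊆ cube N ∧ lambdaN N Γᶜ = 0 ∧ StrictIncOn T Γ

section LinearCombinations

variable {N : ℕ} {T S : (Fin N → ℝ) → Fin N → ℝ} {s t : Set (Fin N → ℝ)} {a b p : ℝ}

theorem Triangular.linearComb (hT : Triangular T) (hS : Triangular S) (a b : ℝ) :
    Triangular fun u => a • T u + b • S u := by
  intro k u v h
  simp only [Pi.add_apply, Pi.smul_apply, hT k u v h, hS k u v h]

theorem IncOn.mono (hT : IncOn T s) (h : t ⊆ s) : IncOn T t :=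
  fun k u hu v hv => hT k u (h hu) v (h hv)

theorem StrictIncOn.mono (hT : StrictIncOn T s) (h : t ⊆ s) : StrictIncOn T t :=
  fun k u hu v hv => hT k u (h hu) v (h hv)

theorem IncOn.linearComb (hT : IncOn T s) (hS : IncOn S s) (ha : 0 ≤ a) (hb : 0 ≤ b) :
    IncOn (fun u => a • T u + b • S u) s := by
  intro k u hu v hv h huv
  simp only [Pi.add_apply, Pi.smul_apply, smul_eq_mul]
  have h₁ := hT k u hu v hv h huv
  have h₂ := hS k u hu v hv h huv
  gcongr

theorem StrictIncOn.linearComb (hT : StrictIncOn T s) (hS : StrictIncOn S s)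
    (ha : 0 ≤ a) (hb : 0 ≤ b) (hab : 0 < a + b) :
    StrictIncOn (fun u => a • T u + b • S u) s := by
  intro k u hu v hv h huv
  simp only [Pi.add_apply, Pi.smul_apply, smul_eq_mul]
  have h₁ := hT k u hu v hv h huv
  have h₂ := hS k u hu v hv h huv
  rcases ha.eq_or_lt with rfl | ha
  · have hb : 0 < b := by simpa using hab
    simpa using mul_lt_mul_of_pos_left h₂ hb
  · exact add_lt_add_of_lt_of_le (mul_lt_mul_of_pos_left h₁ ha)
      (mul_le_mul_of_nonneg_left h₂.le hb)

theorem ConOn.linearComb (hTi : IncOn T s) (hTc : ConOn T s) (hSi : IncOn S s) (hSc : ConOn S s)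
    (ha : 0 ≤ a) (hb : 0 ≤ b) : ConOn (fun u => a • T u + b • S u) s := by
  intro k m hkm u hu v hv h huv
  wlog hle : u k ≤ v k generalizing u v
  · exact (this v hv u hu (fun j hj => (h j hj).symm) huv.symm (le_of_not_ge hle)).symm
  simp only [Pi.add_apply, Pi.smul_apply, smul_eq_mul] at huv ⊢
  have h' : ∀ j < k, u j = v j := fun j hj => h j hj.ne
  have h₁ := mul_le_mul_of_nonneg_left (hTi k u hu v hv h' hle) ha
  have h₂ := mul_le_mul_of_nonneg_left (hSi k u hu v hv h' hle) hb
  obtain ⟨e₁, e₂⟩ := (add_eq_add_iff_eq_and_eq h₁ h₂).1 huv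
  congr 1
  · rcases mul_eq_mul_left_iff.1 e₁ with e | e
    · rw [hTc k m hkm u hu v hv h e]
    · simp [e]
  · rcases mul_eq_mul_left_iff.1 e₂ with e | e
    · rw [hSc k m hkm u hu v hv h e]
    · simp [e]

theorem abs_linearComb_rpow_le (ha : 0 ≤ a) (hb : 0 ≤ b) (hp : 0 ≤ p) (x y : ℝ) :
    |a * x + b * y| ^ p ≤ (a + b) ^ p * (|x| ^ p + |y| ^ p) := by
  have h : |a * x + b * y| ≤ (a + b) * max |x| |y| := by
    calc |a * x + b * y| ≤ a * |x| + b * |y| := by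
          simpa [abs_mul, abs_of_nonneg ha, abs_of_nonneg hb] using abs_add_le (a * x) (b * y)
      _ ≤ a * max |x| |y| + b * max |x| |y| := by
          gcongr
          · exact le_max_left _ _
          · exact le_max_right _ _
      _ = _ := by ring
  calc |a * x + b * y| ^ p ≤ ((a + b) * max |x| |y|) ^ p := by gcongr
    _ = (a + b) ^ p * max |x| |y| ^ p := Real.mul_rpow (by positivity) (by positivity)
    _ ≤ _ := by
        gcongr
        rcases max_choice |x| |y| with h | h <;> rw [h]
        · exact le_add_of_nonneg_right (by positivity)
        · exact le_add_of_nonneg_left (by positivity)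

theorem FinLp.linearComb (hmeas : Measurable T) (hT : FinLp p T) (hS : FinLp p S)
    (ha : 0 ≤ a) (hb : 0 ≤ b) (hp : 0 ≤ p) : FinLp p fun u => a • T u + b • S u := by
  rcases hT with hT | hT
  · exact Or.inl hT
  rcases hS with hS | hS
  · exact Or.inl hS
  right
  have hTm : Measurable fun u => ∑ k, ENNReal.ofReal (|T u k| ^ p) := by
    fun_prop
  calc ∫⁻ u, ∑ k, ENNReal.ofReal (|(a • T u + b • S u) k| ^ p) ∂lambdaN N
      ≤ ∫⁻ u, ENNReal.ofReal ((a + b) ^ p) * (∑ k, ENNReal.ofReal (|T u k| ^ p) +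
          ∑ k, ENNReal.ofReal (|S u k| ^ p)) ∂lambdaN N := by
        refine lintegral_mono fun u => ?_
        dsimp only
        rw [← Finset.sum_add_distrib, Finset.mul_sum]
        refine Finset.sum_le_sum fun k _ => ?_
        rw [← ENNReal.ofReal_add (by positivity) (by positivity),
          ← ENNReal.ofReal_mul (by positivity)]
        exact ENNReal.ofReal_le_ofReal (abs_linearComb_rpow_le ha hb hp _ _)
    _ < ⊤ := by
        rw [lintegral_const_mul' _ _ ENNReal.ofReal_ne_top, lintegral_add_left hTm]
        exact ENNReal.mul_lt_top ENNReal.ofReal_lt_top (ENNReal.add_lt_top.2 ⟨hT, hS⟩)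

theorem IsQuantileProcess.linearComb (hT : IsQuantileProcess T) (hS : IsQuantileProcess S)
    (ha : 0 ≤ a) (hb : 0 ≤ b) : IsQuantileProcess fun u => a • T u + b • S u where
  measurable := (hT.measurable.const_smul a).add (hS.measurable.const_smul b)
  triangular := hT.triangular.linearComb hS.triangular a b
  inc := hT.inc.linearComb hS.inc ha hb
  con := ConOn.linearComb hT.inc hT.con hS.inc hS.con ha hb

theorem lambdaN_compl_inter_eq_zero (hs : lambdaN N sᶜ = 0) (ht : lambdaN N tᶜ = 0) :
    lambdaN N (s ∩ t)ᶜ = 0 := by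
  rw [compl_inter]
  exact measure_union_null hs ht

theorem StrictlyIncreasingTriangular.linearComb (hT : StrictlyIncreasingTriangular T)
    (hS : StrictlyIncreasingTriangular S) (ha : 0 ≤ a) (hb : 0 ≤ b) (hab : 0 < a + b) :
    StrictlyIncreasingTriangular fun u => a • T u + b • S u := by
  obtain ⟨hTm, hTt, Γ, hΓ, hΓ₀, hTi⟩ := hT
  obtain ⟨hSm, hSt, Δ, -, hΔ₀, hSi⟩ := hS
  exact ⟨(hTm.const_smul a).add (hSm.const_smul b), hTt.linearComb hSt a b, Γ ∩ Δ,
    inter_subset_left.trans hΓ, lambdaN_compl_inter_eq_zero hΓ₀ hΔ₀,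
    (hTi.mono inter_subset_left).linearComb (hSi.mono inter_subset_right) ha hb hab⟩

theorem IncreasingTriangular.linearComb (hT : IncreasingTriangular T)
    (hS : IncreasingTriangular S) (ha : 0 ≤ a) (hb : 0 ≤ b) :
    IncreasingTriangular fun u => a • T u + b • S u := by
  obtain ⟨hTm, hTt, Γ, hΓ, hΓ₀, hTi⟩ := hT
  obtain ⟨hSm, hSt, Δ, -, hΔ₀, hSi⟩ := hS
  exact ⟨(hTm.const_smul a).add (hSm.const_smul b), hTt.linearComb hSt a b, Γ ∩ Δ,
    inter_subset_left.trans hΓ, lambdaN_compl_inter_eq_zero hΓ₀ hΔ₀,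
    (hTi.mono inter_subset_left).linearComb (hSi.mono inter_subset_right) ha hb⟩

theorem FinLp.const_smul (hmeas : Measurable T) (hT : FinLp p T) (ha : 0 ≤ a) (hp : 0 ≤ p) :
    FinLp p fun u => a • T u := by
  simpa using FinLp.linearComb hmeas hT hT ha le_rfl hp

end LinearCombinations

/-- Convex combinations of maps satisfying (inc) and (con) again satisfy
(inc) and (con); consequently `L^quantile_p(λ^N)`, `L^SIT_p(λ^N)` and `L^IT_p(λ^N)` are
convex cones in `L_p(λ^N; ℝ^N)`. -/
theorem quantile_SIT_IT_convex_cones (N : ℕ) (p : ℝ) (hp : p = 0 ∨ 1 ≤ p) :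
    -- convex combinations preserve (inc) and (con)
    (∀ (T S : (Fin N → ℝ) → Fin N → ℝ) (α : ℝ), α ∈ Set.Ioo (0:ℝ) 1 →
      Triangular T → Triangular S →
      IncOn T (cube N) → ConOn T (cube N) → IncOn S (cube N) → ConOn S (cube N) →
      IncOn (fun u => (1 - α) • T u + α • S u) (cube N) ∧
      ConOn (fun u => (1 - α) • T u + α • S u) (cube N)) ∧
    -- L^quantile_p is a convex cone
    (∀ (T S : (Fin N → ℝ) → Fin N → ℝ), ∀ α ∈ Set.Icc (0:ℝ) 1,
      IsQuantileProcess T → FinLp p T → IsQuantileProcess S → FinLp p S →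
      IsQuantileProcess (fun u => (1 - α) • T u + α • S u) ∧
        FinLp p (fun u => (1 - α) • T u + α • S u)) ∧
    (∀ (T : (Fin N → ℝ) → Fin N → ℝ) (c : ℝ), 0 < c → IsQuantileProcess T → FinLp p T →
      IsQuantileProcess (fun u => c • T u) ∧ FinLp p (fun u => c • T u)) ∧
    -- L^SIT_p is a convex cone
    (∀ (T S : (Fin N → ℝ) → Fin N → ℝ), ∀ α ∈ Set.Icc (0:ℝ) 1,
      StrictlyIncreasingTriangular T → FinLp p T →
      StrictlyIncreasingTriangular S → FinLp p S →
      StrictlyIncreasingTriangular (fun u => (1 - α) • T u + α • S u) ∧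
        FinLp p (fun u => (1 - α) • T u + α • S u)) ∧
    (∀ (T : (Fin N → ℝ) → Fin N → ℝ) (c : ℝ), 0 < c →
      StrictlyIncreasingTriangular T → FinLp p T →
      StrictlyIncreasingTriangular (fun u => c • T u) ∧ FinLp p (fun u => c • T u)) ∧
    -- L^IT_p is a convex cone
    (∀ (T S : (Fin N → ℝ) → Fin N → ℝ), ∀ α ∈ Set.Icc (0:ℝ) 1,
      IncreasingTriangular T → FinLp p T → IncreasingTriangular S → FinLp p S →
      IncreasingTriangular (fun u => (1 - α) • T u + α • S u) ∧
        FinLp p (fun u => (1 - α) • T u + α • S u)) ∧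
    (∀ (T : (Fin N → ℝ) → Fin N → ℝ) (c : ℝ), 0 < c → IncreasingTriangular T → FinLp p T →
      IncreasingTriangular (fun u => c • T u) ∧ FinLp p (fun u => c • T u)) := by
  have hp₀ : 0 ≤ p := hp.elim ge_of_eq zero_le_one.trans
  refine ⟨?_, ?_, ?_, ?_, ?_, ?_, ?_⟩
  · rintro T S α ⟨h₀, h₁⟩ - - hTi hTc hSi hSc
    have h₁ := (sub_pos.2 h₁).le
    exact ⟨hTi.linearComb hSi h₁ h₀.le, ConOn.linearComb hTi hTc hSi hSc h₁ h₀.le⟩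
  · rintro T S α ⟨h₀, h₁⟩ hT hTp hS hSp
    have h₁ := sub_nonneg.2 h₁
    exact ⟨hT.linearComb hS h₁ h₀, FinLp.linearComb hT.measurable hTp hSp h₁ h₀ hp₀⟩
  · intro T c hc hT hTp
    exact ⟨by simpa using hT.linearComb hT hc.le le_rfl,
      FinLp.const_smul hT.measurable hTp hc.le hp₀⟩
  · rintro T S α ⟨h₀, h₁⟩ hT hTp hS hSp
    have h₁ := sub_nonneg.2 h₁
    exact ⟨hT.linearComb hS h₁ h₀ (by simp), FinLp.linearComb hT.1 hTp hSp h₁ h₀ hp₀⟩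
  · intro T c hc hT hTp
    exact ⟨by simpa using hT.linearComb hT hc.le le_rfl (by simpa using hc),
      FinLp.const_smul hT.1 hTp hc.le hp₀⟩
  · rintro T S α ⟨h₀, h₁⟩ hT hTp hS hSp
    have h₁ := sub_nonneg.2 h₁
    exact ⟨hT.linearComb hS h₁ h₀, FinLp.linearComb hT.1 hTp hSp h₁ h₀ hp₀⟩
  · intro T c hc hT hTp
    exact ⟨by simpa using hT.linearComb hT hc.le le_rfl,
      FinLp.const_smul hT.1 hTp hc.le hp₀⟩
end

section
/- Let p ∈ {0} ∪ [1,∞) and N ≥ 2. There exists a sequence (μ_n)_{n≥1} in P_p(ℝ^N) that is Cauchy with respect to the adapted Wasserstein distance AW_p but contains no Cauchy subsequence with respect to the Knothe–Rosenblatt distance KR_p; indeed inf{KR_p(μ_k, μ_n) : k ≠ n} > 0. In particular the completion of P_p(ℝ^N) with respect to AW_p does not continuously embed into the completion with respect to KR_p. -/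
open MeasureTheory ProbabilityTheory Filter Set
open scoped ENNReal NNReal Topology

/-- `π` is a coupling of `μ` and `ν`. -/
def IsCoupling {α β : Type*} [MeasurableSpace α] [MeasurableSpace β]
    (π : Measure (α × β)) (μ : Measure α) (ν : Measure β) : Prop :=
  π.map Prod.fst = μ ∧ π.map Prod.snd = ν

/-- `κ` is a disintegration (regular conditional law) of `ρ` w.r.t. its first coordinate. -/
def Disintegrates {α β : Type*} [MeasurableSpace α] [MeasurableSpace β]
    (ρ : Measure (α × β)) (κ : Kernel α β) : Prop :=
  ∀ (A : Set α) (B : Set β), MeasurableSet A → MeasurableSet B →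
    ρ (A ×ˢ B) = ∫⁻ a in A, κ a B ∂(ρ.map Prod.fst)

/-- The first `k` coordinates of `x : ℝ^N`. -/
def restr {N : ℕ} (k : Fin N) (x : Fin N → ℝ) : Fin (k : ℕ) → ℝ :=
  fun j => x ⟨j, j.isLt.trans k.isLt⟩

/-- A coupling `π` of `μ` and `ν` is bicausal if, for every `k`, the conditional law under `π`
of `(x_k, y_k)` given `(x_{1:k-1}, y_{1:k-1})` is a.s. a coupling of the conditional law of
`x_k` given `x_{1:k-1}` under `μ` and that of `y_k` given `y_{1:k-1}` under `ν`. -/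
def IsBicausal {N : ℕ} (μ ν : Measure (Fin N → ℝ))
    (π : Measure ((Fin N → ℝ) × (Fin N → ℝ))) : Prop :=
  IsCoupling π μ ν ∧
  ∀ k : Fin N,
    ∃ (κ : Kernel ((Fin (k : ℕ) → ℝ) × (Fin (k : ℕ) → ℝ)) (ℝ × ℝ))
      (κμ κν : Kernel (Fin (k : ℕ) → ℝ) ℝ),
      IsMarkovKernel κ ∧ IsMarkovKernel κμ ∧ IsMarkovKernel κν ∧
      Disintegrates (μ.map fun x => (restr k x, x k)) κμ ∧
      Disintegrates (ν.map fun y => (restr k y, y k)) κν ∧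
      Disintegrates (π.map fun xy => ((restr k xy.1, restr k xy.2), (xy.1 k, xy.2 k))) κ ∧
      ∀ᵐ ab ∂(π.map fun xy => (restr k xy.1, restr k xy.2)),
        IsCoupling (κ ab) (κμ ab.1) (κν ab.2)

/-- The adapted Wasserstein distance `AW_p` (for `p = 0` with cost `|x - y| ∧ 1`). -/
noncomputable def AWdist (p : ℝ) {N : ℕ} (μ ν : Measure (Fin N → ℝ)) : ℝ≥0∞ :=
  ⨅ (π : Measure ((Fin N → ℝ) × (Fin N → ℝ))) (_ : IsBicausal μ ν π),
    if p = 0 then ∫⁻ xy, cost0 xy.1 xy.2 ∂π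
    else (∫⁻ xy, pCost p xy.1 xy.2 ∂π) ^ p⁻¹

instance : IsProbabilityMeasure lambda01 := ⟨by simp [lambda01]⟩

instance (N : ℕ) : IsProbabilityMeasure (lambdaN N) := by
  unfold lambdaN; infer_instance

theorem measurePreserving_eval_lambdaN {N : ℕ} (i : Fin N) :
    MeasurePreserving (Function.eval i) (lambdaN N) lambda01 :=
  measurePreserving_eval (fun _ : Fin N => lambda01) i

theorem ae_mem_Ioo_lambda01 : ∀ᵐ u ∂lambda01, u ∈ Ioo (0 : ℝ) 1 :=
  ae_restrict_mem measurableSet_Ioo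

theorem measurePreserving_fract_mul_lambda01 {k : ℤ} (hk : k ≠ 0) :
    MeasurePreserving (fun u : ℝ => Int.fract (k * u)) lambda01 lambda01 := by
  have hIoc : volume.restrict (Ioc (0 : ℝ) (0 + 1)) = lambda01 := by
    simp [lambda01, restrict_Ioo_eq_restrict_Ioc]
  have hmk : MeasurePreserving ((↑) : ℝ → UnitAddCircle) lambda01 volume :=
    hIoc ▸ UnitAddCircle.measurePreserving_mk 0
  let e : UnitAddCircle → ℝ := fun x => AddCircle.equivIco 1 0 x
  have he : ∀ x : ℝ, e x = Int.fract x := fun x => by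
    simp [e, AddCircle.coe_equivIco_mk_apply]
  have hem : Measurable e :=
    measurable_subtype_coe.comp (AddCircle.measurableEquivIco (1 : ℝ) 0).measurable
  have hepres : MeasurePreserving e volume lambda01 := by
    refine ⟨hem, ?_⟩
    rw [← hmk.map_eq, Measure.map_map hem hmk.measurable]
    conv_rhs => rw [← Measure.map_id (μ := lambda01)]
    refine Measure.map_congr ?_
    filter_upwards [ae_mem_Ioo_lambda01] with u hu
    simp [he, Int.fract_eq_self.2 ⟨hu.1.le, hu.2⟩]
  convert hepres.comp ((Measure.measurePreserving_zsmul volume hk).comp hmk) using 1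
  ext u
  simp only [Function.comp_apply]
  rw [← he, ← zsmul_eq_mul, AddCircle.coe_zsmul]

/-- The `n`-th binary digit of a real number after the binary point. -/
noncomputable def binaryDigit (n : ℕ) (u : ℝ) : ℝ := ((⌊(2 : ℝ) ^ (n + 1) * u⌋ % 2 : ℤ) : ℝ)

theorem measurable_binaryDigit (n : ℕ) : Measurable (binaryDigit n) := by
  unfold binaryDigit
  have h : Measurable fun u : ℝ => ⌊(2 : ℝ) ^ (n + 1) * u⌋ :=
    Int.measurable_floor.comp (measurable_const_mul _)
  exact (measurable_from_top (f := fun z : ℤ => ((z % 2 : ℤ) : ℝ))).comp h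

theorem binaryDigit_eq_zero_or_one (n : ℕ) (u : ℝ) :
    binaryDigit n u = 0 ∨ binaryDigit n u = 1 := by
  unfold binaryDigit
  rcases Int.emod_two_eq_zero_or_one ⌊(2 : ℝ) ^ (n + 1) * u⌋ with h | h <;> simp [h]

theorem binaryDigit_add_half_pow (n : ℕ) (u : ℝ) :
    binaryDigit n (u + (1 / 2) ^ (n + 1)) = 1 - binaryDigit n u := by
  have h : (2 : ℝ) ^ (n + 1) * (u + (1 / 2) ^ (n + 1)) = 2 ^ (n + 1) * u + 1 := by
    rw [mul_add, ← mul_pow]; norm_num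
  unfold binaryDigit
  rw [h, Int.floor_add_one]
  rcases Int.emod_two_eq_zero_or_one ⌊(2 : ℝ) ^ (n + 1) * u⌋ with h | h
  · rw [h, show (⌊(2 : ℝ) ^ (n + 1) * u⌋ + 1) % 2 = 1 by omega]; norm_num
  · rw [h, show (⌊(2 : ℝ) ^ (n + 1) * u⌋ + 1) % 2 = 0 by omega]; norm_num

theorem binaryDigit_add_half_pow_of_lt {m n : ℕ} (hmn : m < n) (u : ℝ) :
    binaryDigit n (u + (1 / 2) ^ (m + 1)) = binaryDigit n u := by
  obtain ⟨d, rfl⟩ := Nat.exists_eq_add_of_lt hmn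
  have h : (2 : ℝ) ^ (m + d + 1 + 1) * (u + (1 / 2) ^ (m + 1)) =
      2 ^ (m + d + 1 + 1) * u + ((2 * 2 ^ d : ℤ) : ℝ) := by
    have : (2 : ℝ) ^ (m + d + 1 + 1) = 2 ^ (m + 1) * (2 * 2 ^ d) := by ring
    rw [mul_add, this, mul_right_comm _ _ ((1 / 2 : ℝ) ^ (m + 1)), ← mul_pow]
    norm_num
  unfold binaryDigit
  rw [h, Int.floor_add_intCast, Int.add_mul_emod_self_left]

theorem binaryDigit_add_intCast (n : ℕ) (u : ℝ) (z : ℤ) :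
    binaryDigit n (u + z) = binaryDigit n u := by
  have h : (2 : ℝ) ^ (n + 1) * (u + z) = 2 ^ (n + 1) * u + ((2 * (2 ^ n * z) : ℤ) : ℝ) := by
    push_cast; ring
  unfold binaryDigit
  rw [h, Int.floor_add_intCast, Int.add_mul_emod_self_left]

theorem binaryDigit_fract (n : ℕ) (u : ℝ) : binaryDigit n (Int.fract u) = binaryDigit n u := by
  simpa [sub_eq_add_neg, Int.fract] using binaryDigit_add_intCast n u (-⌊u⌋)

theorem binaryDigit_fract_two_pow_mul (m n : ℕ) (u : ℝ) :
    binaryDigit m (Int.fract (((2 ^ n : ℤ) : ℝ) * u)) =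
      binaryDigit n (Int.fract (((2 ^ m : ℤ) : ℝ) * u)) := by
  rw [binaryDigit_fract, binaryDigit_fract]
  unfold binaryDigit
  rw [← mul_assoc, ← mul_assoc]
  push_cast
  rw [← pow_add, ← pow_add, add_right_comm, add_right_comm n, add_comm m]

theorem abs_sub_binaryDigit_eq_zero_or_one (m n : ℕ) (u : ℝ) :
    |binaryDigit m u - binaryDigit n u| = 0 ∨ |binaryDigit m u - binaryDigit n u| = 1 := by
  rcases binaryDigit_eq_zero_or_one m u with h | h <;>
    rcases binaryDigit_eq_zero_or_one n u with h' | h' <;> simp [h, h']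

theorem integral_abs_sub_binaryDigit {m n : ℕ} (hmn : m ≠ n) :
    ∫ u, |binaryDigit m u - binaryDigit n u| ∂lambda01 = 1 / 2 := by
  wlog hlt : m < n generalizing m n
  · simpa only [abs_sub_comm] using this hmn.symm (by omega)
  set d : ℝ → ℝ := fun u => |binaryDigit m u - binaryDigit n u| with hd
  have hdm : Measurable d := ((measurable_binaryDigit m).sub (measurable_binaryDigit n)).abs
  have hd1 : ∀ u, ‖d u‖ ≤ 1 := fun u => by
    rcases abs_sub_binaryDigit_eq_zero_or_one m n u with h | h <;> simp [hd, h]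
  have hint : ∀ a b : ℝ, IntervalIntegrable d volume a b := fun a b =>
    (intervalIntegrable_const (c := (1 : ℝ))).mono_fun hdm.aestronglyMeasurable
      (ae_of_all _ fun u => by simpa using hd1 u)
  have hper : Function.Periodic d 1 := fun u => by
    have := binaryDigit_add_intCast m u 1
    have := binaryDigit_add_intCast n u 1
    simp_all
  have hshift : ∀ u, d (u + (1 / 2) ^ (m + 1)) = 1 - d u := fun u => by
    simp only [hd, binaryDigit_add_half_pow, binaryDigit_add_half_pow_of_lt hlt]
    rcases binaryDigit_eq_zero_or_one m u with h | h <;>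
      rcases binaryDigit_eq_zero_or_one n u with h' | h' <;> simp [h, h']
  have h₁ : ∫ u in (0 : ℝ)..1, d (u + (1 / 2) ^ (m + 1)) = ∫ u in (0 : ℝ)..1, d u := by
    rw [intervalIntegral.integral_comp_add_right, add_comm 1]
    simpa using hper.intervalIntegral_add_eq (0 + (1 / 2) ^ (m + 1)) 0
  have h₂ : ∫ u in (0 : ℝ)..1, d (u + (1 / 2) ^ (m + 1)) = 1 - ∫ u in (0 : ℝ)..1, d u := by
    simp_rw [hshift]
    rw [intervalIntegral.integral_sub (by simp) (hint _ _)]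
    simp
  have h₃ : ∫ u, d u ∂lambda01 = ∫ u in (0 : ℝ)..1, d u := by
    rw [intervalIntegral.integral_of_le zero_le_one, lambda01, restrict_Ioo_eq_restrict_Ioc]
  linarith

theorem lintegral_abs_sub_binaryDigit {m n : ℕ} (hmn : m ≠ n) :
    ∫⁻ u, ENNReal.ofReal |binaryDigit m u - binaryDigit n u| ∂lambda01 = 1 / 2 := by
  rw [← ofReal_integral_eq_lintegral_ofReal _ (ae_of_all _ fun _ => abs_nonneg _),
    integral_abs_sub_binaryDigit hmn]
  · rw [ENNReal.ofReal_div_of_pos two_pos]; simp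
  · refine Integrable.of_bound (C := 1) (((measurable_binaryDigit m).sub
      (measurable_binaryDigit n)).abs).aestronglyMeasurable (ae_of_all _ fun u => ?_)
    rcases abs_sub_binaryDigit_eq_zero_or_one m n u with h | h <;> simp [h]

theorem eqOn_Ioo_mul_of_map_lambda01_eq {f : ℝ → ℝ} {a : ℝ} (ha : 0 < a) (hf : Measurable f)
    (hmono : MonotoneOn f (Ioo 0 1)) (hmap : lambda01.map f = lambda01.map fun u => a * u) :
    EqOn f (fun u => a * u) (Ioo 0 1) := by
  have hcdf : ∀ t ∈ Ioo (0 : ℝ) 1, lambda01 {v | f v ≤ a * t} = ENNReal.ofReal t := fun t ht => by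
    calc lambda01 {v | f v ≤ a * t} = lambda01.map f (Iic (a * t)) :=
          (Measure.map_apply hf measurableSet_Iic).symm
      _ = lambda01 (Iic t) := by
          rw [hmap, Measure.map_apply (measurable_const_mul a) measurableSet_Iic]
          congr 1; ext v; simp [mul_le_mul_iff_right₀ ha]
      _ = volume (Ioc 0 t) := by
          rw [lambda01, Measure.restrict_apply measurableSet_Iic]
          congr 1; ext v; simp only [mem_inter_iff, mem_Iic, mem_Ioo, mem_Ioc]
          constructor
          · rintro ⟨h, h', -⟩; exact ⟨h', h⟩
          · rintro ⟨h, h'⟩; exact ⟨h', h, h'.trans_lt ht.2⟩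
      _ = ENNReal.ofReal t := by simp
  have hfm : ∀ t, MeasurableSet {v | f v ≤ t} := fun t => hf measurableSet_Iic
  intro u hu
  rcases lt_trichotomy (f u) (a * u) with h | h | h
  · exfalso
    obtain ⟨t, ht, htu⟩ := exists_between
      (max_lt hu.1 ((div_lt_iff₀ ha).2 (by rwa [mul_comm u a])) : max 0 (f u / a) < u)
    have ht0 := (le_max_left _ _).trans_lt ht
    have htf : f u < a * t := by
      have := (le_max_right _ _).trans_lt ht
      rwa [div_lt_iff₀ ha, mul_comm] at this
    have hle : ENNReal.ofReal u ≤ ENNReal.ofReal t := by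
      rw [← hcdf t ⟨ht0, htu.trans hu.2⟩, lambda01, Measure.restrict_apply (hfm _)]
      calc ENNReal.ofReal u = volume (Ioc 0 u) := by simp
        _ ≤ volume ({v | f v ≤ a * t} ∩ Ioo 0 1) := measure_mono fun v hv =>
          have hv' : v ∈ Ioo (0 : ℝ) 1 := ⟨hv.1, hv.2.trans_lt hu.2⟩
          ⟨(hmono hv' hu hv.2).trans htf.le, hv'⟩
    exact absurd ((ENNReal.ofReal_le_ofReal_iff ht0.le).1 hle) htu.not_ge
  · exact h
  · exfalso
    obtain ⟨t, hut, ht⟩ := exists_between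
      (lt_min hu.2 ((lt_div_iff₀ ha).2 (by rwa [mul_comm u a])) : u < min 1 (f u / a))
    have htf : a * t < f u := by
      have := ht.trans_le (min_le_right _ _)
      rwa [lt_div_iff₀ ha, mul_comm] at this
    have hle : ENNReal.ofReal t ≤ ENNReal.ofReal u := by
      rw [← hcdf t ⟨hu.1.trans hut, ht.trans_le (min_le_left _ _)⟩, lambda01,
        Measure.restrict_apply (hfm _)]
      calc volume ({v | f v ≤ a * t} ∩ Ioo 0 1) ≤ volume (Ioc 0 u) :=
            measure_mono fun v ⟨hvt, hv⟩ => ⟨hv.1, by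
            by_contra! huv
            exact absurd ((hmono hu hv huv.le).trans hvt) htf.not_ge⟩
        _ = ENNReal.ofReal u := by simp
    exact absurd ((ENNReal.ofReal_le_ofReal_iff hu.1.le).1 hle) hut.not_ge

theorem disintegrates_const_of_subsingleton {α β : Type*} [MeasurableSpace α] [MeasurableSpace β]
    [Subsingleton α] (ρ : Measure (α × β)) [IsProbabilityMeasure ρ] :
    Disintegrates ρ (Kernel.const α (ρ.map Prod.snd)) := by
  intro A B _ hB
  rcases A.eq_empty_or_nonempty with rfl | hA
  · simp
  · rw [Subsingleton.eq_univ_of_nonempty hA]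
    simp [Measure.map_apply measurable_fst, Measure.map_apply measurable_snd hB, univ_prod]

theorem disintegrates_deterministic {Ω α β : Type*} [MeasurableSpace Ω] [MeasurableSpace α]
    [MeasurableSpace β] (P : Measure Ω) {X : Ω → α} {Y : Ω → β} {h : α → β} (hX : Measurable X)
    (hh : Measurable h) (hY : ∀ ω, Y ω = h (X ω)) :
    Disintegrates (P.map fun ω => (X ω, Y ω)) (Kernel.deterministic h hh) := by
  intro A B hA hB
  have hYm : Measurable Y := by rw [funext hY]; exact hh.comp hX
  have hset : (fun ω => (X ω, Y ω)) ⁻¹' A ×ˢ B = X ⁻¹' (h ⁻¹' B ∩ A) := by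
    ext ω; simp [hY, and_comm]
  rw [Measure.map_map measurable_fst (hX.prodMk hYm),
    Measure.map_apply (hX.prodMk hYm) (hA.prod hB), hset,
    ← Measure.map_apply hX ((hh hB).inter hA), ← Measure.restrict_apply (hh hB)]
  simp_rw [Kernel.deterministic_apply' hh _ hB]
  exact (lintegral_indicator_one (hh hB)).symm

theorem measurable_restr {N : ℕ} (k : Fin N) : Measurable (restr k) :=
  measurable_pi_lambda _ fun _ => measurable_pi_apply _

theorem isBicausal_map_prodMk {Ω : Type*} [MeasurableSpace Ω] (P : Measure Ω)
    [IsProbabilityMeasure P] {N : ℕ} [NeZero N] {X Y : Ω → Fin N → ℝ} (hX : Measurable X)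
    (hY : Measurable Y) {g h : ℝ → Fin N → ℝ} (hg : Measurable g) (hh : Measurable h)
    (hgX : ∀ ω, X ω = g (X ω 0)) (hhY : ∀ ω, Y ω = h (Y ω 0)) :
    IsBicausal (P.map X) (P.map Y) (P.map fun ω => (X ω, Y ω)) := by
  have hXY : Measurable fun ω => (X ω, Y ω) := hX.prodMk hY
  refine ⟨⟨Measure.map_map measurable_fst hXY, Measure.map_map measurable_snd hXY⟩, fun k => ?_⟩
  have hr := measurable_restr k
  have hk : Measurable fun x : Fin N → ℝ => x k := measurable_pi_apply k
  have hrk : Measurable fun x : Fin N → ℝ => (restr k x, x k) := hr.prodMk hk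
  have hrk₂ : Measurable fun xy : (Fin N → ℝ) × (Fin N → ℝ) =>
      ((restr k xy.1, restr k xy.2), (xy.1 k, xy.2 k)) := by fun_prop
  rw [Measure.map_map hrk hX, Measure.map_map hrk hY, Measure.map_map hrk₂ hXY]
  by_cases hk0 : (k : ℕ) = 0
  · have : IsEmpty (Fin k) := by rw [hk0]; infer_instance
    have : IsProbabilityMeasure (P.map ((fun x : Fin N → ℝ => (restr k x, x k)) ∘ X)) :=
      Measure.isProbabilityMeasure_map (hrk.comp hX).aemeasurable
    have : IsProbabilityMeasure (P.map ((fun x : Fin N → ℝ => (restr k x, x k)) ∘ Y)) :=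
      Measure.isProbabilityMeasure_map (hrk.comp hY).aemeasurable
    have : IsProbabilityMeasure (P.map ((fun xy : (Fin N → ℝ) × (Fin N → ℝ) =>
        ((restr k xy.1, restr k xy.2), (xy.1 k, xy.2 k))) ∘ fun ω => (X ω, Y ω))) :=
      Measure.isProbabilityMeasure_map (hrk₂.comp hXY).aemeasurable
    have := fun (α β : Type) [MeasurableSpace α] [MeasurableSpace β] (ρ : Measure (α × β))
        [IsProbabilityMeasure ρ] =>
      Measure.isProbabilityMeasure_map (μ := ρ) measurable_snd.aemeasurable
    refine ⟨_, _, _, inferInstance, inferInstance, inferInstance,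
      disintegrates_const_of_subsingleton _, disintegrates_const_of_subsingleton _,
      disintegrates_const_of_subsingleton _, ae_of_all _ fun ab => ⟨?_, ?_⟩⟩
    · simp only [Kernel.const_apply]
      rw [Measure.map_map measurable_snd (hrk₂.comp hXY), Measure.map_map measurable_fst
        (measurable_snd.comp (hrk₂.comp hXY)), Measure.map_map measurable_snd (hrk.comp hX)]
      rfl
    · simp only [Kernel.const_apply]
      rw [Measure.map_map measurable_snd (hrk₂.comp hXY), Measure.map_map measurable_snd
        (measurable_snd.comp (hrk₂.comp hXY)), Measure.map_map measurable_snd (hrk.comp hY)]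
      rfl
  · let i : Fin k := ⟨0, Nat.pos_of_ne_zero hk0⟩
    have hgk : Measurable fun a : Fin k → ℝ => g (a i) k := by fun_prop
    have hhk : Measurable fun a : Fin k → ℝ => h (a i) k := by fun_prop
    have hghk : Measurable fun ab : (Fin k → ℝ) × (Fin k → ℝ) => (g (ab.1 i) k, h (ab.2 i) k) :=
      (hgk.comp measurable_fst).prodMk (hhk.comp measurable_snd)
    refine ⟨Kernel.deterministic _ hghk, Kernel.deterministic _ hgk, Kernel.deterministic _ hhk,
      inferInstance, inferInstance, inferInstance,
      disintegrates_deterministic P (hr.comp hX) hgk fun ω => congrFun (hgX ω) k,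
      disintegrates_deterministic P (hr.comp hY) hhk fun ω => congrFun (hhY ω) k,
      disintegrates_deterministic P ((hr.comp hX).prodMk (hr.comp hY)) hghk fun ω =>
        Prod.ext (congrFun (hgX ω) k) (congrFun (hhY ω) k),
      ae_of_all _ fun ab => ?_⟩
    simp only [IsCoupling, Kernel.deterministic_apply, Measure.map_dirac' measurable_fst,
      Measure.map_dirac' measurable_snd, and_self]

theorem AWdist_le_ofReal {N : ℕ} {p : ℝ} (hp : p = 0 ∨ 1 ≤ p) {μ ν : Measure (Fin N → ℝ)}
    {π : Measure ((Fin N → ℝ) × (Fin N → ℝ))} [IsProbabilityMeasure π] (hπ : IsBicausal μ ν π)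
    {δ : ℝ} (hδ : 0 ≤ δ) (i : Fin N)
    (h : ∀ᵐ xy ∂π, |xy.1 i - xy.2 i| ≤ δ ∧ ∀ k ≠ i, xy.1 k = xy.2 k) :
    AWdist p μ ν ≤ ENNReal.ofReal δ := by
  refine (iInf₂_le π hπ).trans ?_
  split_ifs with hp0
  · calc ∫⁻ xy, cost0 xy.1 xy.2 ∂π ≤ ∫⁻ _, ENNReal.ofReal δ ∂π := by
          refine lintegral_mono_ae (h.mono fun xy hxy => ?_)
          refine ENNReal.ofReal_le_ofReal ((min_le_left _ _).trans ?_)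
          refine (pi_norm_le_iff_of_nonneg hδ).2 fun k => ?_
          by_cases hk : k = i
          · subst hk; exact hxy.1
          · simpa [hxy.2 k hk] using hδ
      _ = ENNReal.ofReal δ := by simp
  · have hp1 : 1 ≤ p := hp.resolve_left hp0
    have hp' : 0 < p := by linarith
    calc (∫⁻ xy, pCost p xy.1 xy.2 ∂π) ^ p⁻¹ ≤ (∫⁻ _, ENNReal.ofReal (δ ^ p) ∂π) ^ p⁻¹ := by
          refine ENNReal.rpow_le_rpow (lintegral_mono_ae (h.mono fun xy hxy => ?_)) (by positivity)
          have : pCost p xy.1 xy.2 = ENNReal.ofReal (|xy.1 i - xy.2 i| ^ p) :=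
            Finset.sum_eq_single i (fun k _ hk => by simp [hxy.2 k hk, Real.zero_rpow hp0])
              (by simp)
          rw [this]
          exact ENNReal.ofReal_le_ofReal
            (Real.rpow_le_rpow (abs_nonneg _) hxy.1 hp'.le)
      _ = ENNReal.ofReal δ := by
          rw [lintegral_const, measure_univ, mul_one, ← ENNReal.ofReal_rpow_of_nonneg hδ hp'.le,
            ENNReal.rpow_rpow_inv hp0]

/-- The path whose first value is `u`, scaled by `1 / (n + 1)`, whose second value is the `n`-th
binary digit of `u`, and which vanishes afterwards. -/
noncomputable def digitPath (M n : ℕ) (u : ℝ) : Fin (M + 2) → ℝ := fun k =>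
  if k = 0 then 1 / (n + 1 : ℝ) * u else if k = 1 then binaryDigit n u else 0

section digitPath

variable (M n : ℕ)

@[simp] theorem digitPath_zero (u : ℝ) : digitPath M n u 0 = 1 / (n + 1 : ℝ) * u := rfl

@[simp] theorem digitPath_one (u : ℝ) : digitPath M n u 1 = binaryDigit n u := rfl

theorem measurable_digitPath : Measurable (digitPath M n) := by
  refine measurable_pi_lambda _ fun k => ?_
  unfold digitPath
  have := measurable_binaryDigit n
  split_ifs <;> fun_prop

theorem digitPath_eq_digitPath_apply_zero (u : ℝ) :
    digitPath M n u = digitPath M n ((n + 1 : ℝ) * digitPath M n u 0) := by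
  congr 1
  rw [digitPath_zero]
  field_simp

theorem abs_digitPath_le_one {u : ℝ} (hu : u ∈ Ioo (0 : ℝ) 1) (k : Fin (M + 2)) :
    |digitPath M n u k| ≤ 1 := by
  unfold digitPath
  split_ifs
  · rw [abs_of_nonneg (mul_nonneg (by positivity) hu.1.le)]
    exact mul_le_one₀ ((div_le_one (by positivity)).2 (by simp)) hu.1.le hu.2.le
  · rcases binaryDigit_eq_zero_or_one n u with h | h <;> simp [h]
  · simp

/-- The law of `digitPath M n` under the uniform distribution on `(0,1)`. -/
noncomputable def digitLaw : Measure (Fin (M + 2) → ℝ) := lambda01.map (digitPath M n)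

instance : IsProbabilityMeasure (digitLaw M n) :=
  Measure.isProbabilityMeasure_map (measurable_digitPath M n).aemeasurable

theorem memPp_digitLaw {p : ℝ} (hp : p = 0 ∨ 1 ≤ p) : MemPp p (digitLaw M n) := by
  refine ⟨inferInstance, hp.imp_right fun hp => ?_⟩
  have hm := measurable_digitPath M n
  rw [digitLaw, lintegral_map (by fun_prop) hm]
  calc _ ≤ ∫⁻ _, ∑ _ : Fin (M + 2), (1 : ℝ≥0∞) ∂lambda01 := by
        refine lintegral_mono_ae (ae_mem_Ioo_lambda01.mono fun u hu => ?_)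
        refine Finset.sum_le_sum fun k _ => ENNReal.ofReal_le_one.2 ?_
        exact Real.rpow_le_one (abs_nonneg _) (abs_digitPath_le_one M n hu k) (by linarith)
    _ < ⊤ := by simp [ENNReal.add_lt_top]

theorem isQuantileProcess_digitPath :
    IsQuantileProcess fun u : Fin (M + 2) → ℝ => digitPath M n (u 0) where
  measurable := (measurable_digitPath M n).comp (measurable_pi_apply 0)
  triangular k u v h := by simp only [h 0 (Fin.zero_le k)]
  inc k u _ v _ h huv := by
    rcases (Fin.zero_le k).eq_or_lt' with rfl | hk
    · exact mul_le_mul_of_nonneg_left huv (by positivity)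
    · simp only [h 0 hk, le_refl]
  con k m _ u _ v _ h huv := by
    rcases (Fin.zero_le k).eq_or_lt' with rfl | hk
    · have : u 0 = v 0 := mul_left_cancel₀ (by positivity) huv
      simp only [this]
    · simp only [h 0 hk.ne]

theorem quantileProcess_digitLaw_ae_eq :
    ∀ᵐ u ∂lambdaN (M + 2), quantileProcess (digitLaw M n) u = digitPath M n (u 0) := by
  have hG := measurable_digitPath M n
  obtain ⟨hQ, hmap⟩ : IsQuantileProcess (quantileProcess (digitLaw M n)) ∧
      (lambdaN (M + 2)).map (quantileProcess (digitLaw M n)) = digitLaw M n := by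
    refine Classical.epsilon_spec (p := fun Q => IsQuantileProcess Q ∧
      (lambdaN (M + 2)).map Q = digitLaw M n) ⟨_, isQuantileProcess_digitPath M n, ?_⟩
    rw [digitLaw, ← (measurePreserving_eval_lambdaN (0 : Fin (M + 2))).map_eq,
      Measure.map_map hG (measurable_pi_apply 0)]
    rfl
  set Q := quantileProcess (digitLaw M n)
  have hQ0 : ∀ u : Fin (M + 2) → ℝ, Q u 0 = Q (fun _ => u 0) 0 := fun u =>
    hQ.triangular 0 _ _ fun j hj => by rw [Fin.le_zero_iff.1 hj]
  have hconst : Measurable fun t : ℝ => (fun _ : Fin (M + 2) => t) := by fun_prop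
  have hfm : Measurable fun t : ℝ => Q (fun _ => t) 0 :=
    (measurable_pi_apply 0).comp (hQ.measurable.comp hconst)
  have hfirst : EqOn (fun t : ℝ => Q (fun _ => t) 0) (fun t => 1 / (n + 1 : ℝ) * t) (Ioo 0 1) := by
    refine eqOn_Ioo_mul_of_map_lambda01_eq (by positivity) hfm
      (fun s hs t ht hst => hQ.inc 0 _ (fun _ => hs) _ (fun _ => ht)
        (fun j hj => absurd hj (Fin.not_lt_zero j)) hst) ?_
    calc lambda01.map (fun t : ℝ => Q (fun _ => t) 0)
        = (lambdaN (M + 2)).map fun u => Q u 0 := by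
          rw [← (measurePreserving_eval_lambdaN (0 : Fin (M + 2))).map_eq,
            Measure.map_map hfm (measurable_pi_apply 0)]
          exact congrArg (Measure.map · _) (funext fun u => (hQ0 u).symm)
      _ = (digitLaw M n).map fun x => x 0 := by
          rw [← hmap, Measure.map_map (measurable_pi_apply 0) hQ.measurable]
          rfl
      _ = lambda01.map fun u => 1 / (n + 1 : ℝ) * u := by
          rw [digitLaw, Measure.map_map (measurable_pi_apply 0) hG]
          rfl
  have hgraph : ∀ᵐ u ∂lambdaN (M + 2), Q u = digitPath M n ((n + 1 : ℝ) * Q u 0) := by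
    have hs : MeasurableSet {x : Fin (M + 2) → ℝ | x = digitPath M n ((n + 1 : ℝ) * x 0)} :=
      measurableSet_eq_fun measurable_id (hG.comp (by fun_prop))
    refine (ae_map_iff hQ.measurable.aemeasurable hs).1 ?_
    rw [hmap, digitLaw, ae_map_iff hG.aemeasurable hs]
    exact ae_of_all _ (digitPath_eq_digitPath_apply_zero M n)
  have hcube : ∀ᵐ u ∂lambdaN (M + 2), u 0 ∈ Ioo (0 : ℝ) 1 :=
    (measurePreserving_eval_lambdaN 0).quasiMeasurePreserving.ae ae_mem_Ioo_lambda01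
  filter_upwards [hgraph, hcube] with u hu hu0
  have hu1 : Q (fun _ => u 0) 0 = 1 / (n + 1 : ℝ) * u 0 := hfirst hu0
  rw [hu, hQ0, hu1]
  congr 1
  field_simp

end digitPath

theorem AWdist_digitLaw_le {p : ℝ} (hp : p = 0 ∨ 1 ≤ p) (M : ℕ) {K m n : ℕ} (hm : K ≤ m)
    (hn : K ≤ n) : AWdist p (digitLaw M m) (digitLaw M n) ≤ ENNReal.ofReal (1 / (K + 1 : ℝ)) := by
  have hτ : ∀ j : ℕ, MeasurePreserving (fun u : ℝ => Int.fract (((2 ^ j : ℤ) : ℝ) * u))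
      lambda01 lambda01 := fun j => measurePreserving_fract_mul_lambda01 (by positivity)
  have hlaw : ∀ i j : ℕ, lambda01.map (fun u => digitPath M i
      (Int.fract (((2 ^ j : ℤ) : ℝ) * u))) = digitLaw M i := fun i j => by
    conv_rhs => rw [digitLaw, ← (hτ j).map_eq, Measure.map_map (measurable_digitPath M i)
      (hτ j).measurable]
    rfl
  have hmeas : ∀ i j : ℕ, Measurable fun u : ℝ => digitPath M i
      (Int.fract (((2 ^ j : ℤ) : ℝ) * u)) := fun i j =>
    (measurable_digitPath M i).comp (hτ j).measurable
  have hbic := isBicausal_map_prodMk lambda01 (hmeas m n) (hmeas n m)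
    ((measurable_digitPath M m).comp (measurable_const_mul (m + 1 : ℝ)))
    ((measurable_digitPath M n).comp (measurable_const_mul (n + 1 : ℝ)))
    (fun _ => digitPath_eq_digitPath_apply_zero M m _)
    (fun _ => digitPath_eq_digitPath_apply_zero M n _)
  rw [hlaw, hlaw] at hbic
  have hmeas₂ := (hmeas m n).prodMk (hmeas n m)
  have := Measure.isProbabilityMeasure_map (μ := lambda01) hmeas₂.aemeasurable
  refine AWdist_le_ofReal hp hbic (by positivity) 0 ?_
  refine (ae_map_iff hmeas₂.aemeasurable ?_).2 (ae_of_all _ fun u => ⟨?_, fun k hk => ?_⟩)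
  · simp only [ne_eq, ofPred_and, ofPred_forall]
    refine (measurableSet_le (by fun_prop) measurable_const).inter
      (MeasurableSet.iInter fun k => MeasurableSet.iInter fun _ =>
        measurableSet_eq_fun (by fun_prop) (by fun_prop))
  · have hbd : ∀ j i : ℕ, K ≤ j → 1 / (j + 1 : ℝ) * Int.fract (((2 ^ i : ℤ) : ℝ) * u) ∈
        Icc 0 (1 / (K + 1 : ℝ)) := fun j i hj =>
      ⟨mul_nonneg (by positivity) (Int.fract_nonneg _),
        (mul_le_of_le_one_right (by positivity) (Int.fract_lt_one _).le).trans
          (one_div_le_one_div_of_le (by positivity) (by gcongr))⟩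
    have h₁ := hbd m n hm
    have h₂ := hbd n m hn
    exact abs_sub_le_iff.2 ⟨by simp only [digitPath_zero]; linarith [h₁.2, h₂.1],
      by simp only [digitPath_zero]; linarith [h₂.2, h₁.1]⟩
  · simp only [digitPath, hk, if_false, binaryDigit_fract_two_pow_mul m n]

theorem le_KRdist_digitLaw {p : ℝ} (hp : p = 0 ∨ 1 ≤ p) (M : ℕ) {m n : ℕ} (hmn : m ≠ n) :
    (if p = 0 then 1 / 2 else (1 / 2 : ℝ≥0∞) ^ p⁻¹) ≤
      KRdist p (digitLaw M m) (digitLaw M n) := by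
  have hdigit : ∫⁻ u, ENNReal.ofReal |binaryDigit m (u 0) - binaryDigit n (u 0)|
      ∂lambdaN (M + 2) = 1 / 2 := by
    have hmeas : Measurable fun t => ENNReal.ofReal |binaryDigit m t - binaryDigit n t| :=
      ((measurable_binaryDigit m).sub (measurable_binaryDigit n)).abs.ennreal_ofReal
    rw [← lintegral_abs_sub_binaryDigit hmn]
    exact (measurePreserving_eval_lambdaN (0 : Fin (M + 2))).lintegral_comp hmeas
  have hm := quantileProcess_digitLaw_ae_eq M m
  have hn := quantileProcess_digitLaw_ae_eq M n
  unfold KRdist Ldist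
  split_ifs with hp0
  · rw [← hdigit]
    refine lintegral_mono_ae ?_
    filter_upwards [hm, hn] with u hum hun
    rw [hum, hun]
    refine ENNReal.ofReal_le_ofReal (le_min ?_ ?_)
    · exact norm_le_pi_norm (digitPath M m (u 0) - digitPath M n (u 0)) 1
    · rcases abs_sub_binaryDigit_eq_zero_or_one m n (u 0) with h | h <;> simp [h]
  · have hp1 : 1 ≤ p := hp.resolve_left hp0
    refine ENNReal.rpow_le_rpow ?_ (by positivity)
    rw [← hdigit]
    refine lintegral_mono_ae ?_
    filter_upwards [hm, hn] with u hum hun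
    rw [hum, hun]
    calc ENNReal.ofReal |binaryDigit m (u 0) - binaryDigit n (u 0)|
        = ENNReal.ofReal (|digitPath M m (u 0) 1 - digitPath M n (u 0) 1| ^ p) := by
          simp only [digitPath_one]
          rcases abs_sub_binaryDigit_eq_zero_or_one m n (u 0) with h | h <;>
            simp [h, Real.zero_rpow hp0]
      _ ≤ pCost p (digitPath M m (u 0)) (digitPath M n (u 0)) :=
          Finset.single_le_sum (f := fun k => ENNReal.ofReal
            (|digitPath M m (u 0) k - digitPath M n (u 0) k| ^ p)) (by simp) (Finset.mem_univ 1)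

/-- For `N ≥ 2` there is a sequence in `P_p(ℝ^N)` that is `AW_p`-Cauchy
but whose terms are uniformly `KR_p`-separated, so it contains no `KR_p`-Cauchy
subsequence. -/
theorem exists_AW_cauchy_not_KR_cauchy (N : ℕ) (hN : 2 ≤ N) (p : ℝ) (hp : p = 0 ∨ 1 ≤ p) :
    ∃ μ : ℕ → Measure (Fin N → ℝ),
      (∀ n, MemPp p (μ n)) ∧
      (∀ ε : ℝ≥0∞, 0 < ε → ∃ M : ℕ, ∀ m ≥ M, ∀ n ≥ M, AWdist p (μ m) (μ n) < ε) ∧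
      (∃ c : ℝ≥0∞, 0 < c ∧ ∀ m n : ℕ, m ≠ n → c ≤ KRdist p (μ m) (μ n)) := by
  obtain ⟨M, rfl⟩ := Nat.exists_eq_add_of_le' hN
  refine ⟨digitLaw M, fun n => memPp_digitLaw M n hp, fun ε hε => ?_,
    if p = 0 then 1 / 2 else (1 / 2 : ℝ≥0∞) ^ p⁻¹, ?_, fun m n => le_KRdist_digitLaw hp M⟩
  · have hlim : Tendsto (fun K : ℕ => ENNReal.ofReal (1 / (K + 1 : ℝ))) atTop (𝓝 0) := by
      simpa using ENNReal.tendsto_ofReal tendsto_one_div_add_atTop_nhds_zero_nat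
    obtain ⟨K, hK⟩ := (hlim.eventually_lt_const hε).exists
    exact ⟨K, fun m hm n hn => (AWdist_digitLaw_le hp M hm hn).trans_lt hK⟩
  · split_ifs
    · simp
    · exact ENNReal.rpow_pos (by simp) (by simp)
end

section
/- Let A and B be Polish spaces. The set F(A ⇝ B) of Borel probability measures π on A × B that are concentrated on the graph of a Borel measurable function (i.e., for which there exists a Borel measurable f : A → B with π = (id, f)_# μ, where μ is the first marginal of π) is a G_δ subset of the space P(A × B) of Borel probability measures on A × B equipped with the topology of weak convergence. -/
open MeasureTheory

open Filter Topology BoundedContinuousFunction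
open scoped ENNReal NNReal

/-- Countably many bounded continuous real functions separate the points of a separable
metrizable space. -/
lemma exists_seq_boundedContinuousFunction_injective (B : Type*) [TopologicalSpace B]
    [TopologicalSpace.MetrizableSpace B] [SecondCountableTopology B] :
    ∃ φ : ℕ → B →ᵇ ℝ, Function.Injective fun b k => φ k b := by
  let _ := TopologicalSpace.metrizableSpaceMetric B
  rcases isEmpty_or_nonempty B with hB | hB
  · exact ⟨0, fun b => isEmptyElim b⟩
  let u := TopologicalSpace.denseSeq B
  refine ⟨fun k => BoundedContinuousFunction.ofNormedAddCommGroup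
    (fun b => min (dist b (u k)) 1) (by fun_prop) 1 fun b => ?_, fun b c h => ?_⟩
  · rw [Real.norm_of_nonneg (by positivity)]
    exact min_le_right _ _
  · have h' : (fun x => min (dist b x) 1) = fun x => min (dist c x) 1 :=
      (TopologicalSpace.denseRange_denseSeq B).equalizer (by fun_prop) (by fun_prop) h
    have hb : 0 = min (dist c b) 1 := by simpa using congrFun h' b
    by_contra hne
    exact (lt_min (dist_pos.2 (Ne.symm hne)) one_pos).ne hb

lemma isOpen_setOf_eLpNorm_one_lt {X : Type*} [TopologicalSpace X] [MeasurableSpace X]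
    [OpensMeasurableSpace X] {h : X → ℝ} (hh : Continuous h) {C : ℝ} (hC : ∀ x, ‖h x‖ ≤ C)
    (ε : ℝ≥0∞) : IsOpen {π : ProbabilityMeasure X | eLpNorm h 1 (π : Measure X) < ε} := by
  have hc := ProbabilityMeasure.continuous_lintegral_boundedContinuousFunction
    (BoundedContinuousFunction.ofNormedAddCommGroup h hh C hC).nnnorm
  simp only [eLpNorm_one_eq_lintegral_enorm]
  exact isOpen_lt hc continuous_const

/-- A real function that is an `L¹`-limit of measurable functions of `p` is almost surely a
measurable function of `p`. -/
lemma exists_measurable_ae_eq_comp_of_eLpNorm_lt {X A : Type*} [MeasurableSpace X]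
    [MeasurableSpace A] {π : Measure X} {p : X → A} (hp : Measurable p) {F : X → ℝ}
    (hF : Measurable F)
    (h : ∀ n : ℕ, ∃ g : A → ℝ, Measurable g ∧ eLpNorm (F - g ∘ p) 1 π < (n + 1 : ℝ≥0∞)⁻¹) :
    ∃ G : A → ℝ, Measurable G ∧ F =ᵐ[π] G ∘ p := by
  choose g hg hgF using h
  have hlim : Tendsto (fun n => eLpNorm (g n ∘ p - F) 1 π) atTop (𝓝 0) := by
    refine tendsto_of_tendsto_of_tendsto_of_le_of_le tendsto_const_nhds
      ENNReal.tendsto_inv_nat_nhds_zero (fun _ => zero_le) fun n => ?_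
    rw [← eLpNorm_neg, neg_sub]
    exact (hgF n).le.trans (ENNReal.inv_le_inv.2 le_self_add)
  obtain ⟨ns, -, hns⟩ := (tendstoInMeasure_of_tendsto_eLpNorm one_ne_zero
    (fun n => ((hg n).comp hp).aestronglyMeasurable) hF.aestronglyMeasurable
    hlim).exists_seq_tendsto_ae
  refine ⟨fun a => limsup (fun i => g (ns i) a) atTop, .limsup fun i => hg _, ?_⟩
  filter_upwards [hns] with x hx
  exact hx.limsup_eq.symm

/-- A family of real functions that is injective on `B` reduces almost sure functional dependence
of the second coordinate on the first to that of each member of the family. -/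
lemma exists_measurable_eq_map_graph {A B : Type*} [MeasurableSpace A] [MeasurableSpace B]
    [Nonempty B] {π : Measure (A × B)} {φ : B → ℕ → ℝ} (hφ : MeasurableEmbedding φ)
    (h : ∀ k, ∃ G : A → ℝ, Measurable G ∧ (fun x : A × B => φ x.2 k) =ᵐ[π] G ∘ Prod.fst) :
    ∃ f : A → B, Measurable f ∧ π = (π.map Prod.fst).map fun a => (a, f a) := by
  choose G hG hGφ using h
  obtain ⟨ψ, hψ, hψφ⟩ := hφ.exists_measurable_extend measurable_id fun _ => ‹_›
  have hf : Measurable fun a => ψ fun k => G k a := hψ.comp (measurable_pi_lambda _ hG)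
  refine ⟨_, hf, ?_⟩
  rw [Measure.map_map (measurable_id'.prodMk hf) measurable_fst]
  conv_lhs => rw [← Measure.map_id (μ := π)]
  refine Measure.map_congr ?_
  filter_upwards [ae_all_iff.2 hGφ] with x hx
  have hx' : φ x.2 = fun k => G k x.1 := funext hx
  have hψx : ψ (φ x.2) = x.2 := congrFun hψφ x.2
  simp [← hx', hψx]

lemma exists_boundedContinuous_eLpNorm_lt_of_eq_map_graph {A B : Type*}
    [TopologicalSpace A] [PolishSpace A] [MeasurableSpace A] [BorelSpace A]
    [TopologicalSpace B] [PolishSpace B] [MeasurableSpace B] [BorelSpace B]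
    {π : Measure (A × B)} [IsFiniteMeasure π] {f : A → B} (hf : Measurable f)
    (hπ : π = (π.map Prod.fst).map fun a => (a, f a)) (φ : B →ᵇ ℝ) {ε : ℝ≥0∞} (hε : 0 < ε) :
    ∃ g : A →ᵇ ℝ, eLpNorm (fun x : A × B => φ x.2 - g x.1) 1 π < ε := by
  let _ := TopologicalSpace.upgradeIsCompletelyMetrizable A
  obtain ⟨δ, hδ, hδε⟩ := exists_between hε
  have hφf : MemLp (fun a => φ (f a)) 1 (π.map Prod.fst) :=
    .of_bound (φ.continuous.measurable.comp hf).aestronglyMeasurable ‖φ‖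
      (.of_forall fun a => φ.norm_coe_le_norm _)
  obtain ⟨g, hg, -⟩ := hφf.exists_boundedContinuous_eLpNorm_sub_le ENNReal.one_ne_top hδ.ne'
  refine ⟨g, lt_of_le_of_lt ?_ hδε⟩
  have hc : Continuous fun x : A × B => φ x.2 - g x.1 := by fun_prop
  rw [hπ, eLpNorm_map_measure hc.aestronglyMeasurable (measurable_id'.prodMk hf).aemeasurable]
  exact hg

/-- For Polish spaces `A`, `B`, the set of Borel probability measures on
`A × B` concentrated on the graph of a Borel measurable function is a `G_δ` subset of
`P(A × B)` with the topology of weak convergence. -/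
theorem graphMeasures_Gdelta (A B : Type*)
    [TopologicalSpace A] [PolishSpace A] [MeasurableSpace A] [BorelSpace A]
    [TopologicalSpace B] [PolishSpace B] [MeasurableSpace B] [BorelSpace B] :
    IsGδ {π : ProbabilityMeasure (A × B) |
      ∃ f : A → B, Measurable f ∧
        (π : Measure (A × B)) =
          ((π : Measure (A × B)).map Prod.fst).map fun a => (a, f a)} := by
  obtain ⟨φ, hφ⟩ := exists_seq_boundedContinuousFunction_injective B
  have hφe : MeasurableEmbedding fun b k => φ k b :=
    Continuous.measurableEmbedding (by fun_prop) hφ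
  suffices h : {π : ProbabilityMeasure (A × B) | ∃ f : A → B, Measurable f ∧
      (π : Measure (A × B)) = ((π : Measure (A × B)).map Prod.fst).map fun a => (a, f a)} =
      ⋂ (k : ℕ) (n : ℕ), ⋃ g : A →ᵇ ℝ, {π : ProbabilityMeasure (A × B) |
        eLpNorm (fun x : A × B => φ k x.2 - g x.1) 1 π < (n + 1 : ℝ≥0∞)⁻¹} by
    rw [h]
    refine .iInter fun k => .iInter fun n => (isOpen_iUnion fun g => ?_).isGδ
    exact isOpen_setOf_eLpNorm_one_lt (by fun_prop)
      (fun x => norm_sub_le_of_le ((φ k).norm_coe_le_norm _) (g.norm_coe_le_norm _)) _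
  ext π
  simp only [Set.mem_ofPred_eq, Set.mem_iInter, Set.mem_iUnion]
  refine ⟨fun ⟨f, hf, hπ⟩ k n =>
    exists_boundedContinuous_eLpNorm_lt_of_eq_map_graph hf hπ (φ k) (by simp), fun h => ?_⟩
  have : Nonempty B := π.nonempty.map Prod.snd
  refine exists_measurable_eq_map_graph hφe fun k =>
    exists_measurable_ae_eq_comp_of_eLpNorm_lt measurable_fst
      ((φ k).continuous.measurable.comp measurable_snd) fun n => ?_
  obtain ⟨g, hg⟩ := h k n
  exact ⟨g, g.continuous.measurable, hg⟩
end

section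
/- Let A and B be Polish spaces and γ a Borel probability measure on A. The map f ↦ (id, f)_# γ is a homeomorphism from L_0(γ; B), the space of Borel measurable functions A → B modulo γ-a.e. equality equipped with the topology of convergence in γ-probability, onto the set {π ∈ P(A × B) : π is concentrated on the graph of a measurable function and the first marginal of π is γ}, equipped with the topology of weak convergence. -/
open MeasureTheory Filter
open scoped Topology

theorem map_graph_eq_iff {A B : Type*} [MeasurableSpace A] [MeasurableSpace B]
    [MeasurableEq B] {γ : Measure A} {f g : A → B} (hf : Measurable f) (hg : Measurable g) :
    (γ.map fun a => (a, f a)) = (γ.map fun a => (a, g a)) ↔ f =ᵐ[γ] g := by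
  constructor
  · intro h
    have hS : MeasurableSet {p : A × B | f p.1 = p.2} :=
      measurableSet_eq_fun (hf.comp measurable_fst) measurable_snd
    have hae : ∀ᵐ p ∂(γ.map fun a => (a, g a)), f p.1 = p.2 := by
      rw [← h, ae_map_iff (by fun_prop) hS]
      simp
    exact (ae_map_iff (by fun_prop) hS).1 hae
  · intro h
    refine Measure.map_congr ?_
    filter_upwards [h] with a ha
    rw [ha]

theorem tendsto_integral_comp_graph {A B : Type*} [TopologicalSpace A] [MeasurableSpace A]
    [OpensMeasurableSpace A] [PseudoEMetricSpace B] [MeasurableSpace B]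
    [OpensMeasurableSpace (A × B)] {γ : Measure A} [IsFiniteMeasure γ]
    {f : ℕ → A → B} {g : A → B} (hf : ∀ n, Measurable (f n))
    (hfg : TendstoInMeasure γ f atTop g) (h : BoundedContinuousFunction (A × B) ℝ) :
    Tendsto (fun n => ∫ x, h (x, f n x) ∂γ) atTop (𝓝 (∫ x, h (x, g x) ∂γ)) := by
  refine tendsto_of_subseq_tendsto fun ns hns => ?_
  obtain ⟨ms, -, hms⟩ := (hfg.comp hns).exists_seq_tendsto_ae
  refine ⟨ms, tendsto_integral_of_dominated_convergence (fun _ => ‖h‖) (fun n => ?_)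
    (integrable_const _) (fun n => .of_forall fun a => h.norm_coe_le_norm _) ?_⟩
  · exact (h.continuous.measurable.comp
      (measurable_id.prodMk (hf _))).aestronglyMeasurable
  · filter_upwards [hms] with a ha
    exact (h.continuous.tendsto _).comp (tendsto_const_nhds.prodMk_nhds ha)

/-- Convergence to zero of the measures of a sequence of sets can be tested on the pieces of a
countable cover. -/
theorem tendsto_measure_zero_of_iUnion_eq_univ {A : Type*} [MeasurableSpace A] {γ : Measure A}
    [IsFiniteMeasure γ] {S E : ℕ → Set A} (hE : ∀ i, MeasurableSet (E i))
    (hcover : ⋃ i, E i = Set.univ)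
    (hS : ∀ i, Tendsto (fun n => γ (S n ∩ E i)) atTop (𝓝 0)) :
    Tendsto (fun n => γ (S n)) atTop (𝓝 0) := by
  have hacc : ∀ N, MeasurableSet (Set.accumulate E N) := fun N =>
    MeasurableSet.biUnion (Set.to_countable _) fun i _ => hE i
  have htail : Tendsto (fun N => γ (Set.accumulate E N)ᶜ) atTop (𝓝 0) := by
    have := tendsto_measure_iInter_atTop (μ := γ) (s := fun N => (Set.accumulate E N)ᶜ)
      (fun N => (hacc N).compl.nullMeasurableSet)
      (fun _ _ h => Set.compl_subset_compl.2 (Set.monotone_accumulate h))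
      ⟨0, measure_ne_top _ _⟩
    rwa [← Set.compl_iUnion, Set.iUnion_accumulate, hcover, Set.compl_univ, measure_empty] at this
  rw [ENNReal.tendsto_nhds_zero]
  intro δ hδ
  have hδ' : 0 < δ / 2 := ENNReal.half_pos hδ.ne'
  obtain ⟨N, hN⟩ := (ENNReal.tendsto_nhds_zero.1 htail _ hδ').exists
  have hsum : Tendsto (fun n => ∑ i ∈ Finset.range (N + 1), γ (S n ∩ E i)) atTop (𝓝 0) := by
    simpa using tendsto_finsetSum (Finset.range (N + 1)) fun i _ => hS i
  filter_upwards [ENNReal.tendsto_nhds_zero.1 hsum _ hδ'] with n hn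
  have hsub : S n ⊆ (⋃ i ∈ Finset.range (N + 1), S n ∩ E i) ∪ (Set.accumulate E N)ᶜ := by
    intro a ha
    by_cases h : a ∈ Set.accumulate E N
    · obtain ⟨i, hi, hai⟩ := Set.mem_accumulate.1 h
      exact .inl (Set.mem_biUnion (Finset.mem_coe.2 (Finset.mem_range.2 (by omega))) ⟨ha, hai⟩)
    · exact .inr h
  calc γ (S n) ≤ γ (⋃ i ∈ Finset.range (N + 1), S n ∩ E i) + γ (Set.accumulate E N)ᶜ :=
        (measure_mono hsub).trans (measure_union_le _ _)
    _ ≤ δ / 2 + δ / 2 := add_le_add ((measure_biUnion_finset_le _ _).trans hn) hN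
    _ = δ := ENNReal.add_halves δ

theorem limsup_measure_graph_preimage_le {A B : Type*} [TopologicalSpace A] [MeasurableSpace A]
    [TopologicalSpace B] [MeasurableSpace B] [OpensMeasurableSpace (A × B)]
    [HasOuterApproxClosed (A × B)]
    {γ : Measure A} [IsProbabilityMeasure γ]
    {f : ℕ → A → B} {g : A → B} (hf : ∀ n, Measurable (f n)) (hg : Measurable g)
    (hfg : ∀ h : BoundedContinuousFunction (A × B) ℝ,
      Tendsto (fun n => ∫ x, h (x, f n x) ∂γ) atTop (𝓝 (∫ x, h (x, g x) ∂γ)))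
    {C : Set (A × B)} (hC : IsClosed C) :
    limsup (fun n => γ {a | (a, f n a) ∈ C}) atTop ≤ γ {a | (a, g a) ∈ C} := by
  have hmeas : ∀ {u : A → B}, Measurable u → Measurable fun a => (a, u a) :=
    fun hu => measurable_id.prodMk hu
  let P : {u : A → B // Measurable u} → ProbabilityMeasure (A × B) := fun u =>
    ⟨γ.map fun a => (a, u.1 a), Measure.isProbabilityMeasure_map (hmeas u.2).aemeasurable⟩
  have hP : Tendsto (fun n => P ⟨f n, hf n⟩) atTop (𝓝 (P ⟨g, hg⟩)) := by
    rw [ProbabilityMeasure.tendsto_iff_forall_integral_tendsto]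
    intro h
    have hint : ∀ u, ∫ p, h p ∂(P u : Measure (A × B)) = ∫ x, h (x, u.1 x) ∂γ := fun u =>
      integral_map (hmeas u.2).aemeasurable h.continuous.measurable.aestronglyMeasurable
    simpa only [hint] using hfg h
  have hval : ∀ u, (P u : Measure (A × B)) C = γ {a | (a, u.1 a) ∈ C} := fun u =>
    Measure.map_apply (hmeas u.2) hC.measurableSet
  simpa only [hval] using ProbabilityMeasure.limsup_measure_closed_le_of_tendsto hP hC

theorem tendstoInMeasure_of_tendsto_integral_graph {A B : Type*}
    [TopologicalSpace A] [TopologicalSpace.PseudoMetrizableSpace A] [MeasurableSpace A]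
    [BorelSpace A] [PseudoMetricSpace B] [SecondCountableTopology B]
    [MeasurableSpace B] [BorelSpace B] [OpensMeasurableSpace (A × B)]
    {γ : Measure A} [IsProbabilityMeasure γ]
    {f : ℕ → A → B} {g : A → B} (hf : ∀ n, Measurable (f n)) (hg : Measurable g)
    (hfg : ∀ h : BoundedContinuousFunction (A × B) ℝ,
      Tendsto (fun n => ∫ x, h (x, f n x) ∂γ) atTop (𝓝 (∫ x, h (x, g x) ∂γ))) :
    TendstoInMeasure γ f atTop g := by
  let := TopologicalSpace.pseudoMetrizableSpacePseudoMetric A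
  have : Nonempty A := nonempty_of_isProbabilityMeasure γ
  have : Nonempty B := this.map g
  rw [tendstoInMeasure_iff_dist]
  intro ε hε
  let E : ℕ → Set A := fun i => g ⁻¹' Metric.ball (TopologicalSpace.denseSeq B i) (ε / 2)
  have hE : ∀ i, MeasurableSet (E i) := fun i => hg measurableSet_ball
  refine tendsto_measure_zero_of_iUnion_eq_univ hE ?_ fun i => ?_
  · refine Set.eq_univ_of_forall fun a => ?_
    obtain ⟨i, hi⟩ :=
      (TopologicalSpace.denseRange_denseSeq B).exists_dist_lt (g a) (half_pos hε)
    exact Set.mem_iUnion.2 ⟨i, hi⟩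
  rw [ENNReal.tendsto_nhds_zero]
  intro δ hδ
  have hδ' : 0 < δ / 2 := ENNReal.half_pos hδ.ne'
  obtain ⟨F, hFE, hF, hFδ⟩ :=
    (hE i).exists_isClosed_sdiff_lt (measure_ne_top γ _) hδ'.ne'
  let b := TopologicalSpace.denseSeq B i
  have hC : IsClosed (F ×ˢ {y : B | ε / 2 ≤ dist y b}) :=
    hF.prod (isClosed_le continuous_const (continuous_id.dist continuous_const))
  have hzero : {a | (a, g a) ∈ F ×ˢ {y : B | ε / 2 ≤ dist y b}} = ∅ := by
    refine Set.eq_empty_of_forall_notMem fun a ha => ?_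
    have hlt : dist (g a) b < ε / 2 := hFE ha.1
    exact hlt.not_ge ha.2
  have hlim := limsup_measure_graph_preimage_le hf hg hfg hC
  rw [hzero, measure_empty] at hlim
  filter_upwards [eventually_lt_of_limsup_lt (hlim.trans_lt hδ')] with n hn
  have hsub : {a | ε ≤ dist (f n a) (g a)} ∩ E i ⊆
      {a | (a, f n a) ∈ F ×ˢ {y : B | ε / 2 ≤ dist y b}} ∪ (E i \ F) := by
    rintro a ⟨ha, hai⟩
    by_cases haF : a ∈ F
    · refine .inl ⟨haF, ?_⟩
      have h₁ : ε ≤ dist (f n a) (g a) := ha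
      have h₂ : dist (g a) b < ε / 2 := hai
      have h₃ := dist_triangle_right (f n a) (g a) b
      change ε / 2 ≤ dist (f n a) b
      linarith
    · exact .inr ⟨hai, haF⟩
  calc _ ≤ _ := (measure_mono hsub).trans (measure_union_le _ _)
    _ ≤ δ / 2 + δ / 2 := add_le_add hn.le hFδ.le
    _ = δ := ENNReal.add_halves δ

/-- For a Polish space `A` with a Borel probability measure `γ` and a Polish
metric space `B`, the map `f ↦ (id, f)_# γ` is a homeomorphism from `L_0(γ; B)` (measurable
maps modulo `γ`-a.e. equality, with convergence in `γ`-probability) onto the set of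
probability measures on `A × B` concentrated on a graph and with first marginal `γ`
(with the topology of weak convergence): it is injective modulo a.e. equality, surjective
onto that set, and bicontinuous (expressed sequentially, both spaces being metrizable). -/
theorem graph_map_homeomorphism (A B : Type*)
    [TopologicalSpace A] [PolishSpace A] [MeasurableSpace A] [BorelSpace A]
    [MetricSpace B] [CompleteSpace B] [SecondCountableTopology B]
    [MeasurableSpace B] [BorelSpace B]
    (γ : Measure A) [IsProbabilityMeasure γ] :
    -- injectivity modulo a.e. equality
    (∀ f g : A → B, Measurable f → Measurable g →
      ((γ.map fun a => (a, f a)) = (γ.map fun a => (a, g a)) ↔ f =ᵐ[γ] g)) ∧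
    -- surjectivity onto the graph measures with first marginal γ
    (∀ π : Measure (A × B), IsProbabilityMeasure π → π.map Prod.fst = γ →
      (∃ f : A → B, Measurable f ∧ π = (π.map Prod.fst).map fun a => (a, f a)) →
      ∃ f : A → B, Measurable f ∧ π = γ.map fun a => (a, f a)) ∧
    -- bicontinuity: convergence in probability ↔ weak convergence of the graph measures
    (∀ (f : ℕ → A → B) (g : A → B), (∀ n, Measurable (f n)) → Measurable g →
      (TendstoInMeasure γ f atTop g ↔
        ∀ h : BoundedContinuousFunction (A × B) ℝ,
          Tendsto (fun n => ∫ x, h (x, f n x) ∂γ) atTop (𝓝 (∫ x, h (x, g x) ∂γ)))) := by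
  refine ⟨fun f g hf hg => map_graph_eq_iff hf hg, ?_, fun f g hf hg =>
    ⟨tendsto_integral_comp_graph hf, tendstoInMeasure_of_tendsto_integral_graph hf hg⟩⟩
  rintro π - rfl h
  exact h
end
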